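/- arXiv:2506.08904 — 6 statements merged into one kernel-verified Lean document; each statement's English description precedes it below -/
import Mathlib

section
/- Let G be a finite group whose Sylow 2-subgroups are semidihedral, and let φ be an automorphism of G. Suppose there is a unit u of the integral group ring ℤ[G] (the monoid algebra of G over ℤ) such that for every g ∈ G the element of ℤ[G] corresponding to φ(g) equals u⁻¹ · g · u (where g is identified with its image in ℤ[G]). Then φ is an inner automorphism of G. (Equivalently, Aut_ℤ(G) = Inn(G), so G satisfies the normalizer problem.) -/
/-- A finite 2-group of order `2^n` (`n ≥ 4`) is semidihedral if it is generated by
elements `a`, `b` with `a^(2^(n-1)) = 1`, `b^2 = 1` and `b⁻¹ * a * b = a^(2^(n-2) - 1)`. -/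
def IsSemidihedral (S : Type*) [Group S] : Prop :=
  ∃ n : ℕ, 4 ≤ n ∧ Nat.card S = 2 ^ n ∧ ∃ a b : S,
    a ^ (2 ^ (n - 1)) = 1 ∧ b ^ 2 = 1 ∧ b⁻¹ * a * b = a ^ (2 ^ (n - 2) - 1) ∧
    Subgroup.closure {a, b} = ⊤

/-- An automorphism is class-preserving if it maps every element to a conjugate of itself. -/
def IsClassPres {G : Type*} [Group G] (φ : MulAut G) : Prop :=
  ∀ g : G, IsConj g (φ g)

/-- An automorphism is Coleman if its restriction to every Sylow subgroup is given by
conjugation by some element of the group. -/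
def IsColemanAut {G : Type*} [Group G] (φ : MulAut G) : Prop :=
  ∀ p : ℕ, p.Prime → ∀ P : Sylow p G, ∃ x : G, ∀ u ∈ (P : Subgroup G), φ u = x⁻¹ * u * x

/-- An automorphism is inner if it is conjugation by some group element. -/
def IsInnerAut {G : Type*} [Group G] (φ : MulAut G) : Prop :=
  ∃ g : G, φ = MulAut.conj g

section DihedralArguments

variable {Γ : Type*} [Group Γ]

/-- An element is isolated if it is the only conjugate of itself that commutes with it. -/
def IsIsolated (t : Γ) : Prop :=
  ∀ x, IsConj t x → Commute x t → x = t

theorem isConj_conj (g t : Γ) : IsConj t (g * t * g⁻¹) := isConj_iff.2 ⟨g, rfl⟩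

theorem IsConj.mul_self_eq_one {t x : Γ} (h : IsConj t x) (ht : t * t = 1) : x * x = 1 := by
  obtain ⟨g, rfl⟩ := isConj_iff.1 h
  calc g * t * g⁻¹ * (g * t * g⁻¹) = g * (t * t) * g⁻¹ := by group
    _ = 1 := by rw [ht]; group

theorem IsIsolated.eq_of_commute {t x y : Γ} (hI : IsIsolated t) (hx : IsConj t x)
    (hy : IsConj t y) (h : Commute y x) : y = x := by
  obtain ⟨g, rfl⟩ := isConj_iff.1 hx
  have h1 : g⁻¹ * y * g = t := by
    refine hI _ (hy.trans (isConj_iff.2 ⟨g⁻¹, by group⟩)) ?_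
    have h2 := h.eq
    have h3 : g⁻¹ * (y * (g * t * g⁻¹)) * g = g⁻¹ * ((g * t * g⁻¹) * y) * g := by rw [h2]
    show g⁻¹ * y * g * t = t * (g⁻¹ * y * g)
    calc _ = g⁻¹ * (y * (g * t * g⁻¹)) * g := by group
      _ = _ := h3
      _ = _ := by group
  rw [← h1]; group

theorem conj_pow_of_mul_self {x k : Γ} (hx : x * x = 1) (h : x * k * x = k⁻¹) (j : ℕ) :
    x * k ^ j = (k ^ j)⁻¹ * x := by
  have h0 : SemiconjBy x k k⁻¹ := by
    show x * k = k⁻¹ * x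
    rw [← h, mul_assoc, hx, mul_one]
  simpa using (h0.pow_right j).eq

theorem odd_orderOf_mul_of_isIsolated [Finite Γ] {t x y : Γ} (ht : t * t = 1)
    (hI : IsIsolated t) (hx : IsConj t x) (hy : IsConj t y) : Odd (orderOf (x * y)) := by
  have hxx := hx.mul_self_eq_one ht
  have hyy := hy.mul_self_eq_one ht
  have hkx : x * (x * y) * x = (x * y)⁻¹ := by
    rw [mul_inv_rev, ← mul_assoc, hxx, one_mul, inv_eq_of_mul_eq_one_left hyy,
      inv_eq_of_mul_eq_one_left hxx]
  have hky : y * (x * y) * y = (x * y)⁻¹ := by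
    rw [mul_inv_rev, mul_assoc, mul_assoc, hyy, mul_one, ← eq_inv_of_mul_eq_one_left hyy,
      ← eq_inv_of_mul_eq_one_left hxx]
  have hpos : 0 < orderOf (x * y) := orderOf_pos _
  set k := x * y with hk
  by_contra hodd
  obtain ⟨m, hm⟩ := (Nat.not_odd_iff_even.1 hodd)
  have hw : k ^ m * k ^ m = 1 := by rw [← pow_add, ← hm, pow_orderOf_eq_one]
  have hw1 : k ^ m ≠ 1 := fun h => by
    have := orderOf_dvd_of_pow_eq_one h
    have := Nat.le_of_dvd (by omega) this
    omega
  have hwinv : (k ^ m)⁻¹ = k ^ m := inv_eq_of_mul_eq_one_left hw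
  rcases Nat.even_or_odd' m with ⟨l, rfl | rfl⟩
  · have h1 := conj_pow_of_mul_self hxx hkx (2 * l)
    have h2 := conj_pow_of_mul_self hxx hkx l
    have h3 : k ^ (2 * l) * x = x := by
      refine hI.eq_of_commute hx (hx.trans (isConj_iff.2 ⟨k ^ l, ?_⟩)) ?_
      · have : x * (k ^ l)⁻¹ = k ^ l * x := by
          have := h2
          rw [mul_inv_eq_iff_eq_mul, mul_assoc, h2, mul_inv_cancel_left]
        rw [mul_assoc, this, two_mul, pow_add, mul_assoc]
      · show _ = _
        rw [mul_assoc, hxx, ← mul_assoc, h1, hwinv, mul_assoc, hxx]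
    exact hw1 (mul_eq_right.1 h3)
  · have h1 := conj_pow_of_mul_self hyy hky (2 * l + 1)
    have h2 := conj_pow_of_mul_self hxx hkx l
    have h3 : k ^ (2 * l + 1) * y = y := by
      refine hI.eq_of_commute hy (hx.trans (isConj_iff.2 ⟨k ^ l, ?_⟩)) ?_
      · have : x * (k ^ l)⁻¹ = k ^ l * x := by
          rw [mul_inv_eq_iff_eq_mul, mul_assoc, h2, mul_inv_cancel_left]
        rw [mul_assoc, this, pow_succ, mul_assoc, two_mul, pow_add, hk, mul_assoc x, hyy, mul_one,
          mul_assoc]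
      · show _ = _
        rw [mul_assoc, hyy, ← mul_assoc, h1, hwinv, mul_assoc, hyy]
    exact hw1 (mul_eq_right.1 h3)

theorem IsIsolated.exists_zpowers_conj [Finite Γ] {t x y : Γ} (ht : t * t = 1)
    (hI : IsIsolated t) (hx : IsConj t x) (hy : IsConj t y) :
    ∃ c ∈ Subgroup.zpowers (x * y), c * y * c⁻¹ = x := by
  obtain ⟨m, hm⟩ := odd_orderOf_mul_of_isIsolated ht hI hx hy
  have hxx := hx.mul_self_eq_one ht
  have hyy := hy.mul_self_eq_one ht
  have hky : y * (x * y) * y = (x * y)⁻¹ := by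
    rw [mul_inv_rev, mul_assoc, mul_assoc, hyy, mul_one, ← eq_inv_of_mul_eq_one_left hyy,
      ← eq_inv_of_mul_eq_one_left hxx]
  have h1 := conj_pow_of_mul_self hyy hky (m + 1)
  refine ⟨(x * y) ^ (m + 1), pow_mem (Subgroup.mem_zpowers _) _, ?_⟩
  have : y * ((x * y) ^ (m + 1))⁻¹ = (x * y) ^ (m + 1) * y := by
    rw [mul_inv_eq_iff_eq_mul, mul_assoc, h1, mul_inv_cancel_left]
  rw [mul_assoc, this, ← mul_assoc, ← pow_add,
    show m + 1 + (m + 1) = orderOf (x * y) + 1 by omega, pow_succ, pow_orderOf_eq_one, one_mul,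
    mul_assoc, hyy, mul_one]

theorem commute_of_mem_zpowers {g k c : Γ} (hc : c ∈ Subgroup.zpowers k) (h : Commute g k) :
    Commute g c := by
  obtain ⟨i, rfl⟩ := Subgroup.mem_zpowers_iff.1 hc
  exact h.zpow_right i

theorem IsIsolated.eq_one_of_inverted [Finite Γ] {t y n : Γ} (ht : t * t = 1)
    (hI : IsIsolated t) (hy : IsConj t y) (hn : Odd (orderOf n)) (hyn : Commute y n)
    (htn : t * n * t⁻¹ = n⁻¹) : n = 1 := by
  obtain ⟨m, hm⟩ := odd_orderOf_mul_of_isIsolated ht hI hy (IsConj.refl t)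
  obtain ⟨l, hl⟩ := hn
  have hk : SemiconjBy (y * t) n n⁻¹ := by
    refine SemiconjBy.mul_left (y := n⁻¹) hyn.inv_right ?_
    show t * n = n⁻¹ * t
    rw [← htn]; group
  have hk' : SemiconjBy (y * t) n⁻¹ n := by simpa using hk.inv_right
  have h2 : Commute ((y * t) ^ 2) n := by
    rw [pow_two]; exact hk'.mul_left hk
  have h3 : SemiconjBy ((y * t) ^ (2 * m + 1)) n n⁻¹ := by
    rw [pow_succ, pow_mul]
    exact SemiconjBy.mul_left (h2.inv_right.pow_left m) hk
  rw [← hm, pow_orderOf_eq_one] at h3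
  have h4 : n = n⁻¹ := by simpa [SemiconjBy] using h3
  have h5 : n ^ 2 = 1 := by rw [pow_two]; nth_rw 1 [h4]; simp
  have h6 : n ^ (2 * l + 1) = 1 := by rw [← hl, pow_orderOf_eq_one]
  rwa [pow_succ, pow_mul, h5, one_pow, one_mul] at h6

theorem IsIsolated.commute_mul_of_normalizes [Finite Γ] {t v x : Γ} (ht : t * t = 1)
    (hI : IsIsolated t) (H : Subgroup Γ)
    (hvH : ∀ y ∈ H, v * y * v⁻¹ ∈ H) (hx : IsConj t x) (hxH : x ∈ H)
    (hv2 : Commute (v * v) x)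
    (hu : ∀ y, IsConj t y → y ∈ H → Commute y v → y = t) : Commute x (t * v) := by
  have hxx := hx.mul_self_eq_one ht
  set x' := v * x * v⁻¹ with hx'
  have hcx' : IsConj t x' := hx.trans (isConj_conj v x)
  have hx'x' := hcx'.mul_self_eq_one ht
  obtain ⟨m, hm⟩ := odd_orderOf_mul_of_isIsolated ht hI hx hcx'
  have hvx' : v * x' * v⁻¹ = x := by
    rw [hx']
    calc v * (v * x * v⁻¹) * v⁻¹ = (v * v) * x * (v * v)⁻¹ := by group
      _ = x := by rw [hv2.eq]; group
  have hxinv : x⁻¹ = x := inv_eq_of_mul_eq_one_left hxx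
  have hx'inv : x'⁻¹ = x' := inv_eq_of_mul_eq_one_left hx'x'
  set s := x * x' with hs
  have hsx : x * s * x = s⁻¹ := by
    rw [hs, mul_inv_rev, ← mul_assoc, hxx, one_mul, hxinv, hx'inv]
  have hsv : SemiconjBy v s s⁻¹ := by
    show v * s = s⁻¹ * v
    rw [hs, mul_inv_rev, hxinv, hx'inv]
    calc v * (x * x') = (v * x * v⁻¹) * (v * x' * v⁻¹) * v := by group
      _ = x' * x * v := by rw [hvx', ← hx']
  -- an exponent `j` with `4 j + 1` divisible by the order of `s`
  obtain ⟨j, hj⟩ : ∃ j : ℕ, s ^ (4 * j + 1) = 1 := by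
    rcases Nat.even_or_odd' m with ⟨r, rfl | rfl⟩
    · exact ⟨r, by rw [show 4 * r + 1 = 2 * (2 * r) + 1 by ring, ← hm, pow_orderOf_eq_one]⟩
    · refine ⟨3 * r + 2, ?_⟩
      rw [show 4 * (3 * r + 2) + 1 = (2 * (2 * r + 1) + 1) * 3 by ring, ← hm, pow_mul,
        pow_orderOf_eq_one, one_pow]
  have hflip : ∀ i : ℕ, x * (s ^ i)⁻¹ = s ^ i * x := fun i => by
    rw [mul_inv_eq_iff_eq_mul, mul_assoc, conj_pow_of_mul_self hxx hsx i, mul_inv_cancel_left]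
  have hx's : x' = (s)⁻¹ * x := by rw [hs, mul_inv_rev, hxinv, hx'inv, mul_assoc, hxx, mul_one]
  have hx'H : x' ∈ H := hvH x hxH
  have hsH : s ∈ H := H.mul_mem hxH hx'H
  have key : s ^ j * x * (s ^ j)⁻¹ = t := by
    refine hu _ (hx.trans (isConj_conj _ x))
      (H.mul_mem (H.mul_mem (H.pow_mem hsH j) hxH) (H.inv_mem (H.pow_mem hsH j))) ?_
    have e1 : s ^ j * x * (s ^ j)⁻¹ = s ^ (2 * j) * x := by
      rw [mul_assoc, hflip, ← mul_assoc, ← pow_add, two_mul]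
    rw [e1]
    show _ = _
    have e2 : v * s ^ (2 * j) = (s ^ (2 * j))⁻¹ * v := by simpa using (hsv.pow_right (2 * j)).eq
    have e3 : v * x = x' * v := by rw [hx']; group
    have e4 : s ^ (2 * j) = (s ^ (2 * j))⁻¹ * s⁻¹ := by
      rw [← mul_inv_rev, eq_inv_iff_mul_eq_one, ← pow_succ', ← pow_add]
      convert hj using 2; ring
    rw [← mul_assoc, e2, mul_assoc _ v, e3, hx's]
    nth_rw 1 [e4]
    group
  have key' : t = s ^ (2 * j) * x := by
    rw [← key, mul_assoc, hflip, ← mul_assoc, ← pow_add, two_mul]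
  have : t * x' * t⁻¹ = x := by
    have htinv : t⁻¹ = t := inv_eq_of_mul_eq_one_left ht
    rw [htinv]
    nth_rw 2 [key']
    rw [key', hx's]
    have f1 : x * s⁻¹ = s * x := by simpa using hflip 1
    have f2 : x * (s ^ (2 * j)) = (s ^ (2 * j))⁻¹ * x := conj_pow_of_mul_self hxx hsx _
    calc s ^ (2 * j) * x * (s⁻¹ * x) * (s ^ (2 * j) * x)
        = s ^ (2 * j) * (x * s⁻¹) * (x * s ^ (2 * j)) * x := by group
      _ = s ^ (2 * j) * s * (x * (s ^ (2 * j))⁻¹) * (x * x) := by rw [f1, f2]; group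
      _ = s ^ (2 * j) * s * s ^ (2 * j) * x := by rw [hflip, hxx]; group
      _ = s ^ (4 * j + 1) * x := by
        rw [← pow_succ, ← pow_add]; congr 2; ring
      _ = x := by rw [hj, one_mul]
  show x * (t * v) = t * v * x
  have e3 : v * x = x' * v := by rw [hx']; group
  rw [mul_assoc t, e3]
  nth_rw 1 [← this]
  group

end DihedralArguments

section Covering

theorem Subgroup.eq_top_of_forall_conj_mem {G : Type*} [Group G] [Finite G] (H : Subgroup G)
    (h : ∀ g, ∃ k, k * g * k⁻¹ ∈ H) : H = ⊤ := by
  classical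
  have := Fintype.ofFinite G
  have hfin : Finite (G ⧸ H) := inferInstance
  have := Fintype.ofFinite (G ⧸ H)
  have : Fintype (MulAction.orbitRel.Quotient G (G ⧸ H)) := Fintype.ofFinite _
  have hB := MulAction.sum_card_fixedBy_eq_card_orbits_mul_card_group G (G ⧸ H)
  have hsub : Subsingleton (MulAction.orbitRel.Quotient G (G ⧸ H)) :=
    (MulAction.pretransitive_iff_subsingleton_quotient G (G ⧸ H)).1 inferInstance
  have h1 : Fintype.card (MulAction.orbitRel.Quotient G (G ⧸ H)) ≤ 1 :=
    Fintype.card_le_one_iff_subsingleton.2 hsub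
  have hge : ∀ g : G, 1 ≤ Fintype.card (MulAction.fixedBy (G ⧸ H) g) := by
    intro g
    obtain ⟨k, hk⟩ := h g
    refine Fintype.card_pos_iff.2 ⟨⟨((k⁻¹ : G) : G ⧸ H), ?_⟩⟩
    rw [MulAction.mem_fixedBy]
    show ((g * k⁻¹ : G) : G ⧸ H) = _
    rw [eq_comm, QuotientGroup.eq]
    simpa [mul_assoc] using hk
  have heq : ∑ g : G, Fintype.card (MulAction.fixedBy (G ⧸ H) g) ≤ ∑ g : G, 1 := by
    rw [hB]
    simp only [Finset.sum_const, Finset.card_univ, smul_eq_mul, mul_one]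
    nlinarith
  have hone := (Finset.sum_eq_sum_iff_of_le (fun g _ => hge g)).1
    (le_antisymm (Finset.sum_le_sum fun g _ => hge g) heq) 1 (Finset.mem_univ _)
  have hX : Fintype.card (G ⧸ H) = 1 := by
    rw [hone]
    refine Fintype.card_congr ⟨fun x => ⟨x, by simp⟩, fun x => x.1, fun _ => rfl, fun _ => rfl⟩
  rw [← Subgroup.index_eq_one, Subgroup.index, Nat.card_eq_fintype_card, hX]

theorem Subgroup.forall_commute_of_forall_conj_commute {Γ : Type*} [Group Γ] [Finite Γ]
    (K : Subgroup Γ) (t : Γ) (h : ∀ g ∈ K, ∃ k ∈ K, Commute (k * g * k⁻¹) t) :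
    ∀ g ∈ K, Commute g t := by
  have := Subgroup.eq_top_of_forall_conj_mem ((Subgroup.centralizer {t}).subgroupOf K) (by
    rintro ⟨g, hg⟩
    obtain ⟨k, hk, hc⟩ := h g hg
    refine ⟨⟨k, hk⟩, ?_⟩
    rw [Subgroup.mem_subgroupOf, Subgroup.mem_centralizer_singleton_iff]
    exact hc.eq)
  intro g hg
  have h2 : (⟨g, hg⟩ : K) ∈ (Subgroup.centralizer {t}).subgroupOf K := this ▸ Subgroup.mem_top _
  rw [Subgroup.mem_subgroupOf, Subgroup.mem_centralizer_singleton_iff] at h2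
  exact h2

end Covering

section Semidihedral

/-- The elements `a` and `b` are standard generators of the semidihedral subgroup `S` of order
`4 * N`. -/
structure SemidihedralGenerators {Γ : Type*} [Group Γ] (S : Subgroup Γ) (a b : Γ) (N : ℕ) :
    Prop where
  pos : 0 < N
  four_dvd : 4 ∣ N
  orderOf_eq : orderOf a = 2 * N
  b_mul_b : b * b = 1
  b_notMem : b ∉ Subgroup.zpowers a
  conj : b * a * b = a ^ (N - 1)
  a_mem : a ∈ S
  b_mem : b ∈ S
  cover : ∀ s ∈ S, ∃ i : ℤ, s = a ^ i ∨ s = a ^ i * b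

/-- The involutions of `S` different from `z`. -/
def IsNoncentralInvolution {Γ : Type*} [Group Γ] (S : Subgroup Γ) (z e : Γ) : Prop :=
  e ∈ S ∧ e * e = 1 ∧ e ≠ 1 ∧ e ≠ z

namespace SemidihedralGenerators

variable {Γ : Type*} [Group Γ] {S : Subgroup Γ} {a b : Γ} {N : ℕ}

theorem zpow_eq_one_iff (D : SemidihedralGenerators S a b N) (i : ℤ) :
    a ^ i = 1 ↔ (2 * N : ℤ) ∣ i := by
  rw [← orderOf_dvd_iff_zpow_eq_one, D.orderOf_eq]; push_cast; rfl

theorem zpow_eq_zpow_iff (D : SemidihedralGenerators S a b N) (i j : ℤ) :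
    a ^ i = a ^ j ↔ (2 * N : ℤ) ∣ i - j := by
  rw [← D.zpow_eq_one_iff, zpow_sub, mul_inv_eq_one]

theorem b_mul_zpow (D : SemidihedralGenerators S a b N) (i : ℤ) :
    b * a ^ i = a ^ (i * (N - 1)) * b := by
  have h : SemiconjBy b a (a ^ ((N : ℤ) - 1)) := by
    have h1 : ((N : ℤ) - 1) = ((N - 1 : ℕ) : ℤ) := by have := D.pos; omega
    show b * a = _ * b
    rw [h1, zpow_natCast, ← D.conj, mul_assoc, D.b_mul_b, mul_one]
  have h2 := (h.zpow_right i).eq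
  rwa [← zpow_mul, mul_comm _ i] at h2

theorem zpow_mul_b_mul_self (D : SemidihedralGenerators S a b N) (i : ℤ) :
    (a ^ i * b) * (a ^ i * b) = a ^ (i * N) := by
  rw [mul_assoc, ← mul_assoc b, D.b_mul_zpow, mul_assoc, D.b_mul_b, mul_one, ← zpow_add]
  congr 1; ring

theorem z_mem (D : SemidihedralGenerators S a b N) : a ^ N ∈ S := pow_mem D.a_mem _

theorem z_mul_z (D : SemidihedralGenerators S a b N) : a ^ N * a ^ N = 1 := by
  rw [← pow_add, ← two_mul, ← D.orderOf_eq, pow_orderOf_eq_one]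

theorem z_ne_one (D : SemidihedralGenerators S a b N) : a ^ N ≠ 1 := fun h => by
  have h1 := Nat.le_of_dvd D.pos (orderOf_dvd_of_pow_eq_one h)
  have := D.pos
  rw [D.orderOf_eq] at h1
  omega

theorem b_comm_z (D : SemidihedralGenerators S a b N) : Commute b (a ^ N) := by
  show _ = _
  rw [← zpow_natCast, D.b_mul_zpow]
  congr 1
  rw [D.zpow_eq_zpow_iff]
  obtain ⟨M, hM⟩ := D.four_dvd
  exact ⟨2 * M - 1, by rw [hM]; push_cast; ring⟩

theorem z_comm (D : SemidihedralGenerators S a b N) {s : Γ} (hs : s ∈ S) : Commute s (a ^ N) := by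
  have ha : ∀ i : ℤ, Commute (a ^ i) (a ^ N) := fun i => by
    rw [← zpow_natCast]; exact Commute.zpow_zpow_self a i N
  obtain ⟨i, rfl | rfl⟩ := D.cover s hs
  · exact ha i
  · exact (ha i).mul_left D.b_comm_z

theorem zpow_eq_one_or_of_sq (D : SemidihedralGenerators S a b N) {i : ℤ}
    (h : (2 * N : ℤ) ∣ 2 * i) : a ^ i = 1 ∨ a ^ i = a ^ N := by
  have h' : (N : ℤ) ∣ i := (mul_dvd_mul_iff_left two_ne_zero).1 h
  obtain ⟨k, rfl⟩ := h'
  obtain ⟨l, rfl | rfl⟩ := Int.even_or_odd' k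
  · left; rw [D.zpow_eq_one_iff]; exact ⟨l, by ring⟩
  · right; rw [← zpow_natCast, D.zpow_eq_zpow_iff]; exact ⟨l, by ring⟩

theorem isNoncentralInvolution_zpow_mul_b (D : SemidihedralGenerators S a b N) (i : ℤ) :
    IsNoncentralInvolution S (a ^ N) (a ^ (2 * i) * b) := by
  have hb : ∀ j : ℤ, a ^ (2 * i) * b ≠ a ^ j := fun j h => D.b_notMem
    ⟨-(2 * i) + j, by simp only [zpow_add]; rw [← h]; simp⟩
  refine ⟨mul_mem (zpow_mem D.a_mem _) D.b_mem, ?_, ?_, ?_⟩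
  · rw [D.zpow_mul_b_mul_self, D.zpow_eq_one_iff]; exact ⟨i, by ring⟩
  · simpa using hb 0
  · simpa using hb N

theorem eq_zpow_mul_b_of_isNoncentralInvolution (D : SemidihedralGenerators S a b N) {e : Γ}
    (he : IsNoncentralInvolution S (a ^ N) e) : ∃ i : ℤ, e = a ^ (2 * i) * b := by
  obtain ⟨hS, he2, he1, hez⟩ := he
  have hN : (N : ℤ) ≠ 0 := by exact_mod_cast D.pos.ne'
  obtain ⟨i, rfl | rfl⟩ := D.cover e hS
  · exfalso
    rw [← zpow_add, D.zpow_eq_one_iff, ← two_mul] at he2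
    exact (D.zpow_eq_one_or_of_sq he2).elim he1 hez
  · rw [D.zpow_mul_b_mul_self, D.zpow_eq_one_iff] at he2
    obtain ⟨k, hk⟩ := (mul_dvd_mul_iff_right hN).1 he2
    exact ⟨k, by rw [hk]⟩

theorem zpow_eq_one_or_of_commute (D : SemidihedralGenerators S a b N) {i j : ℤ}
    (h : Commute (a ^ j) (a ^ i * b)) : a ^ j = 1 ∨ a ^ j = a ^ N := by
  have h1 : a ^ (i + j) * b = a ^ (i + j * (N - 1)) * b := by
    have := h.eq
    rw [mul_assoc, D.b_mul_zpow, ← mul_assoc, ← mul_assoc, ← zpow_add, ← zpow_add] at this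
    rw [← this, add_comm]
  have h2 := (D.zpow_eq_zpow_iff _ _).1 (mul_right_cancel h1)
  apply D.zpow_eq_one_or_of_sq
  obtain ⟨M, hM⟩ := D.four_dvd
  obtain ⟨k, hk⟩ := h2
  have hM' : (N : ℤ) = 4 * M := by exact_mod_cast hM
  rw [hM'] at hk ⊢
  refine ⟨k * (1 - 2 * M) + (1 - M) * j, ?_⟩
  linear_combination (1 - 2 * (M : ℤ)) * hk

theorem eq_of_commute_noncentral (D : SemidihedralGenerators S a b N) {e s : Γ}
    (he : IsNoncentralInvolution S (a ^ N) e) (hs : s ∈ S) (h : Commute s e) :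
    s = 1 ∨ s = a ^ N ∨ s = e ∨ s = e * a ^ N := by
  obtain ⟨i, hi⟩ := D.eq_zpow_mul_b_of_isNoncentralInvolution he
  obtain ⟨j, rfl | rfl⟩ := D.cover s hs
  · rcases D.zpow_eq_one_or_of_commute (hi ▸ h) with h | h <;> simp [h]
  · have hj : a ^ j * b = a ^ (j - 2 * i) * e := by
      rw [hi, ← mul_assoc, ← zpow_add]; congr 2; ring
    have h1 : Commute (a ^ (j - 2 * i)) e := by
      have h2 : a ^ (j - 2 * i) = a ^ j * b * e⁻¹ := by rw [hj, mul_inv_cancel_right]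
      rw [h2]
      exact h.mul_left (Commute.refl e).inv_left
    rcases D.zpow_eq_one_or_of_commute (hi ▸ h1) with h | h
    · right; right; left; rw [hj, h, one_mul]
    · right; right; right; rw [hj, h, (D.z_comm he.1).eq]

theorem exists_conj_noncentral (D : SemidihedralGenerators S a b N) {e e' : Γ}
    (he : IsNoncentralInvolution S (a ^ N) e) (he' : IsNoncentralInvolution S (a ^ N) e') :
    ∃ s ∈ S, s * e * s⁻¹ = e' := by
  obtain ⟨i, rfl⟩ := D.eq_zpow_mul_b_of_isNoncentralInvolution he
  obtain ⟨j, rfl⟩ := D.eq_zpow_mul_b_of_isNoncentralInvolution he'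
  obtain ⟨M, hM⟩ := D.four_dvd
  refine ⟨a ^ ((j - i) * (1 - 2 * M)), zpow_mem D.a_mem _, ?_⟩
  rw [← zpow_neg, mul_assoc, mul_assoc, D.b_mul_zpow, ← mul_assoc, ← mul_assoc, ← zpow_add,
    ← zpow_add]
  congr 1
  rw [D.zpow_eq_zpow_iff, hM]
  push_cast
  exact ⟨(j - i) * (M - 1), by ring⟩

theorem eq_of_forall_commute (D : SemidihedralGenerators S a b N) {s : Γ} (hs : s ∈ S)
    (h : ∀ x ∈ S, Commute s x) : s = 1 ∨ s = a ^ N := by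
  obtain ⟨i, rfl | rfl⟩ := D.cover s hs
  · exact D.zpow_eq_one_or_of_commute (i := 0) (by simpa using h b D.b_mem)
  · exfalso
    have h1 := D.zpow_eq_one_or_of_commute (i := i) (j := 1) (by simpa using (h a D.a_mem).symm)
    have h2 : (2 * N : ℤ) ∣ 2 := by
      rw [← D.zpow_eq_one_iff]
      rw [zpow_one] at h1
      rw [zpow_two]
      rcases h1 with h1 | h1
      · rw [h1, one_mul]
      · rw [h1, D.z_mul_z]
    have := Int.le_of_dvd (by norm_num) h2
    have := D.pos
    have := Nat.le_of_dvd D.pos D.four_dvd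
    omega

theorem isNoncentralInvolution_b (D : SemidihedralGenerators S a b N) :
    IsNoncentralInvolution S (a ^ N) b := by
  simpa using D.isNoncentralInvolution_zpow_mul_b 0

theorem isNoncentralInvolution_b_mul_z (D : SemidihedralGenerators S a b N) :
    IsNoncentralInvolution S (a ^ N) (b * a ^ N) := by
  obtain ⟨M, hM⟩ := D.four_dvd
  convert D.isNoncentralInvolution_zpow_mul_b (2 * M) using 1
  rw [D.b_comm_z.eq, ← zpow_natCast, hM]
  congr 2
  push_cast
  ring

end SemidihedralGenerators

end Semidihedral

section Sylow

variable {Γ : Type*} [Group Γ] [Finite Γ]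

open scoped Pointwise in
theorem Sylow.exists_conj_mem {p : ℕ} [Fact p.Prime] (T : Sylow p Γ) {R : Subgroup Γ}
    (hR : IsPGroup p R) : ∃ h : Γ, ∀ r ∈ R, h⁻¹ * r * h ∈ T := by
  obtain ⟨T', hT'⟩ := hR.exists_le_sylow
  obtain ⟨h, rfl⟩ := MulAction.exists_smul_eq Γ T T'
  refine ⟨h, fun r hr => ?_⟩
  have h1 : r ∈ MulAut.conj h • (T : Subgroup Γ) := hT' hr
  rw [Subgroup.mem_smul_pointwise_iff_exists] at h1
  obtain ⟨s, hs, rfl⟩ := h1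
  have h2 : h⁻¹ * MulAut.conj h s * h = s := by simp [mul_assoc]
  show h⁻¹ * MulAut.conj h s * h ∈ T
  rw [h2]
  exact hs

theorem Sylow.exists_conj_mem_of_commute {p : ℕ} [Fact p.Prime] (T : Sylow p Γ) {R : Subgroup Γ}
    (hR : IsPGroup p R) {x : Γ} (hx : IsPGroup p (Subgroup.zpowers x))
    (hc : ∀ r ∈ R, Commute x r) : ∃ h : Γ, (∀ r ∈ R, h⁻¹ * r * h ∈ T) ∧ h⁻¹ * x * h ∈ T := by
  have hle : Subgroup.zpowers x ≤ Subgroup.normalizer R := by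
    rw [Subgroup.zpowers_le]
    refine Subgroup.centralizer_le_normalizer _ (Subgroup.mem_centralizer_iff.2 fun r hr => ?_)
    exact (hc r hr).symm.eq
  obtain ⟨h, hh⟩ := T.exists_conj_mem (hx.to_sup_of_normal_right' hR hle)
  exact ⟨h, fun r hr => hh r (Subgroup.mem_sup_right hr),
    hh x (Subgroup.mem_sup_left (Subgroup.mem_zpowers x))⟩

theorem exists_odd_pow_isPGroup_two (x : Γ) :
    ∃ m, Odd m ∧ IsPGroup 2 (Subgroup.zpowers (x ^ m)) := by
  obtain ⟨k, m, hm, h⟩ := Nat.exists_eq_two_pow_mul_odd (orderOf_pos x).ne'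
  refine ⟨m, hm, IsPGroup.of_card (n := k) ?_⟩
  rw [Nat.card_zpowers, orderOf_pow, h, Nat.gcd_mul_left_left, Nat.mul_div_cancel _ hm.pos]

end Sylow

theorem isPGroup_two_zpowers_of_mul_self {Γ : Type*} [Group Γ] {x : Γ} (hx : x * x = 1) :
    IsPGroup 2 (Subgroup.zpowers x) := by
  rw [← pow_two] at hx
  rintro ⟨y, i, rfl⟩
  refine ⟨1, ?_⟩
  ext
  show (x ^ i) ^ (2 ^ 1) = 1
  rw [pow_one, ← zpow_natCast, ← zpow_mul, mul_comm, zpow_mul]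
  norm_cast
  rw [hx, one_zpow]

theorem pow_mem_iff_of_index_two {Γ : Type*} [Group Γ] {G : Subgroup Γ} (hG : G.index = 2)
    {x : Γ} {m : ℕ} (hm : Odd m) : x ^ m ∈ G ↔ x ∈ G := by
  obtain ⟨r, rfl⟩ := hm
  rw [pow_succ, Subgroup.mul_mem_cancel_left]
  rw [pow_mul]
  exact pow_mem (Subgroup.sq_mem_of_index_two hG x) r

section Main

/-- A finite group `Γ` with a subgroup `G` of index two, whose Sylow 2-subgroup `T ⊓ G` is
semidihedral, such that each 2-subgroup of `G` and element of `G` centralizing it have a common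
centralizing element outside `G`. -/
structure SemidihedralExtension {Γ : Type*} [Group Γ] (G : Subgroup Γ) (T : Sylow 2 Γ)
    (a b : Γ) (N : ℕ) : Prop where
  index : G.index = 2
  gens : SemidihedralGenerators ((T : Subgroup Γ) ⊓ G) a b N
  lift : ∀ Q : Subgroup Γ, Q ≤ G → IsPGroup 2 Q → ∀ g ∈ G, (∀ q ∈ Q, Commute g q) →
    ∃ x, x ∉ G ∧ (∀ q ∈ Q, Commute x q) ∧ Commute x g

/-- An involution outside `G` that is central in `T`. -/
structure IsOuterCentralInvolution {Γ : Type*} [Group Γ] (G T : Subgroup Γ) (t : Γ) : Prop where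
  mem : t ∈ T
  notMem : t ∉ G
  mul_self : t * t = 1
  comm : ∀ x ∈ T, Commute t x

namespace SemidihedralExtension

variable {Γ : Type*} [Group Γ] {G : Subgroup Γ} {T : Sylow 2 Γ} {a b : Γ} {N : ℕ}

theorem normal (E : SemidihedralExtension G T a b N) : G.Normal :=
  Subgroup.normal_of_index_eq_two E.index

theorem notMem_of_isConj (E : SemidihedralExtension G T a b N) {t x : Γ} (ht : t ∉ G)
    (h : IsConj t x) : x ∉ G := by
  have := E.normal
  obtain ⟨g, rfl⟩ := isConj_iff.1 h
  intro h1
  apply ht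
  simpa [mul_assoc] using this.conj_mem _ h1 g⁻¹

theorem mul_mem_of_notMem (E : SemidihedralExtension G T a b N) {x y : Γ} (hx : x ∉ G)
    (hy : y ∉ G) : x * y ∈ G := by
  rw [Subgroup.mul_mem_iff_of_index_two E.index]; simp [hx, hy]

theorem isOuterCentralInvolution_mul_z (E : SemidihedralExtension G T a b N) {t : Γ}
    (ht : IsOuterCentralInvolution G T t) : IsOuterCentralInvolution G T (t * a ^ N) := by
  have hz := E.gens.z_mem
  have hcz : ∀ x ∈ (T : Subgroup Γ), Commute x (a ^ N) := by
    intro x hx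
    by_cases hxG : x ∈ G
    · exact E.gens.z_comm ⟨hx, hxG⟩
    · have h1 : t * x ∈ (T : Subgroup Γ) ⊓ G :=
        ⟨mul_mem ht.mem hx, E.mul_mem_of_notMem ht.notMem hxG⟩
      have h2 : x = t * (t * x) := by rw [← mul_assoc, ht.mul_self, one_mul]
      rw [h2]
      exact (ht.comm _ hz.1).mul_left (E.gens.z_comm h1)
  refine ⟨mul_mem ht.mem hz.1, ?_, ?_, ?_⟩
  · intro h
    exact ht.notMem ((Subgroup.mul_mem_cancel_right _ hz.2).1 h)
  · rw [mul_assoc, ← mul_assoc (a ^ N), ← (ht.comm _ hz.1).eq, mul_assoc, E.gens.z_mul_z, mul_one,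
      ht.mul_self]
  · exact fun x hx => (ht.comm x hx).mul_left (hcz x hx).symm

theorem eq_z_of_conj_normalizer (E : SemidihedralExtension G T a b N) {n : Γ}
    (hn : n ∈ Subgroup.normalizer (T : Set Γ)) : n⁻¹ * a ^ N * n = a ^ N := by
  have hN := E.normal
  have hz := E.gens.z_mem
  have hn' := Subgroup.inv_mem _ hn
  have hmem : n⁻¹ * a ^ N * n ∈ (T : Subgroup Γ) ⊓ G := by
    refine ⟨?_, ?_⟩
    · have := (Subgroup.mem_normalizer_iff.1 hn' (a ^ N)).1 hz.1
      rwa [inv_inv] at this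
    · simpa using hN.conj_mem _ hz.2 n⁻¹
  refine (E.gens.eq_of_forall_commute hmem fun x hx => ?_).resolve_left ?_
  · have hx' : n * x * n⁻¹ ∈ (T : Subgroup Γ) ⊓ G :=
      ⟨(Subgroup.mem_normalizer_iff.1 hn x).1 hx.1, hN.conj_mem _ hx.2 n⟩
    have := (E.gens.z_comm hx').eq
    show _ = _
    calc n⁻¹ * a ^ N * n * x = n⁻¹ * (a ^ N * (n * x * n⁻¹)) * n := by group
      _ = n⁻¹ * (n * x * n⁻¹ * a ^ N) * n := by rw [this]
      _ = _ := by group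
  · intro h
    apply E.gens.z_ne_one
    have : a ^ N = n * (n⁻¹ * a ^ N * n) * n⁻¹ := by group
    rw [this, h]; group

variable [Finite Γ]

theorem exists_lift (E : SemidihedralExtension G T a b N) {Q : Subgroup Γ} (hQ : Q ≤ G)
    (hQ2 : IsPGroup 2 Q) {g : Γ} (hg : g ∈ G) (hc : ∀ q ∈ Q, Commute g q) :
    ∃ h x, x ∈ T ∧ x ∉ G ∧ (∀ q ∈ Q, h⁻¹ * q * h ∈ T) ∧ (∀ q ∈ Q, Commute x (h⁻¹ * q * h)) ∧
      Commute (h * x * h⁻¹) g := by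
  obtain ⟨x, hxG, hxQ, hxg⟩ := E.lift Q hQ hQ2 g hg hc
  obtain ⟨m, hm, hpm⟩ := exists_odd_pow_isPGroup_two x
  obtain ⟨h, h1, h2⟩ := T.exists_conj_mem_of_commute hQ2 hpm
    fun q hq => (hxQ q hq).pow_left m
  refine ⟨h, h⁻¹ * x ^ m * h, h2, ?_, h1, fun q hq => ?_, ?_⟩
  · refine E.notMem_of_isConj (t := x ^ m) ?_ (isConj_iff.2 ⟨h⁻¹, by simp⟩)
    rwa [pow_mem_iff_of_index_two E.index hm]
  · have := ((hxQ q hq).pow_left m).eq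
    show _ = _
    calc h⁻¹ * x ^ m * h * (h⁻¹ * q * h) = h⁻¹ * (x ^ m * q) * h := by group
      _ = h⁻¹ * (q * x ^ m) * h := by rw [this]
      _ = _ := by group
  · have : h * (h⁻¹ * x ^ m * h) * h⁻¹ = x ^ m := by group
    rw [this]
    exact hxg.pow_left m

theorem isIsolated_of_forall_mem (_E : SemidihedralExtension G T a b N) {t : Γ}
    (ht : IsOuterCentralInvolution G T t)
    (h : ∀ x, IsConj t x → x ∈ T → x = t) : IsIsolated t := by
  intro x hx hc
  have hxx := hx.mul_self_eq_one ht.mul_self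
  obtain ⟨k, h1, h2⟩ := T.exists_conj_mem_of_commute
    (isPGroup_two_zpowers_of_mul_self ht.mul_self) (isPGroup_two_zpowers_of_mul_self hxx)
    fun r hr => commute_of_mem_zpowers hr hc
  have h3 := h _ (isConj_iff.2 ⟨k⁻¹, by simp⟩) (h1 t (Subgroup.mem_zpowers t))
  have h4 := h _ (hx.trans (isConj_iff.2 ⟨k⁻¹, by simp⟩)) h2
  have h5 : k⁻¹ * t * k = k⁻¹ * x * k := h3.trans h4.symm
  simpa using h5.symm

theorem not_isConj_mul_z (E : SemidihedralExtension G T a b N) {t : Γ}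
    (ht : IsOuterCentralInvolution G T t) : ¬ IsConj t (t * a ^ N) := by
  intro h
  obtain ⟨g, hg⟩ := isConj_iff.1 h
  have htz := E.isOuterCentralInvolution_mul_z ht
  have hcen : ∀ {t : Γ}, IsOuterCentralInvolution G T t → t ∈ Subgroup.centralizer (T : Set Γ) :=
    fun ht => Subgroup.mem_centralizer_iff.2 fun x hx => ((ht.comm x hx).eq).symm
  obtain ⟨n, hn, hn2⟩ := T.conj_eq_normalizer_conj_of_mem_centralizer t g⁻¹ (hcen ht)
    (by rw [inv_inv, hg]; exact hcen htz)
  rw [inv_inv, hg] at hn2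
  have hz := E.eq_z_of_conj_normalizer hn
  have hswap : n⁻¹ * (t * a ^ N) * n = t := by
    calc n⁻¹ * (t * a ^ N) * n = (n⁻¹ * t * n) * (n⁻¹ * a ^ N * n) := by group
      _ = t := by rw [← hn2, hz, mul_assoc, E.gens.z_mul_z, mul_one]
  have h2 : Commute (n ^ 2) t := by
    show _ = _
    have h3 : (n ^ 2)⁻¹ * t * n ^ 2 = t := by
      calc (n ^ 2)⁻¹ * t * n ^ 2 = n⁻¹ * (n⁻¹ * t * n) * n := by rw [pow_two]; group
        _ = t := by rw [← hn2, hswap]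
    nth_rw 1 [← h3]; group
  obtain ⟨m, ⟨r, rfl⟩, hp⟩ := exists_odd_pow_isPGroup_two n
  have hmem : n ^ (2 * r + 1) ∈ (T : Subgroup Γ) := by
    have h4 : n ^ (2 * r + 1) ∈ Subgroup.zpowers (n ^ (2 * r + 1)) ⊓
        Subgroup.normalizer (T : Set Γ) := ⟨Subgroup.mem_zpowers _, pow_mem hn _⟩
    have h5 := hp.inf_normalizer_sylow T
    rw [h5] at h4
    exact h4.2
  have h6 := (ht.comm _ hmem).eq
  rw [pow_succ, pow_mul] at h6
  have h7 := (h2.pow_left r).eq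
  have h8 : t * n = n * t := by
    rw [← mul_assoc, ← h7, mul_assoc, mul_assoc] at h6
    exact mul_left_cancel h6
  rw [mul_assoc, h8, inv_mul_cancel_left] at hn2
  exact E.gens.z_ne_one (by simpa using hn2)

theorem isIsolated_or (E : SemidihedralExtension G T a b N) {t : Γ}
    (ht : IsOuterCentralInvolution G T t) : IsIsolated t ∨ IsIsolated (t * a ^ N) := by
  by_contra! hcon
  have htz := E.isOuterCentralInvolution_mul_z ht
  have htzz : t * a ^ N * a ^ N = t := by rw [mul_assoc, E.gens.z_mul_z, mul_one]
  -- a conjugate of `τ` in `T` other than `τ` is conjugate to `τ * b`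
  have key : ∀ τ, IsOuterCentralInvolution G T τ → ¬ IsIsolated τ →
      ∃ e, IsNoncentralInvolution ((T : Subgroup Γ) ⊓ G) (a ^ N) e ∧ IsConj τ (τ * e) := by
    intro τ hτ hni
    by_contra! hno
    apply hni
    refine E.isIsolated_of_forall_mem hτ fun x hx hxT => ?_
    have hxG := E.notMem_of_isConj hτ.notMem hx
    have hs : τ * x ∈ (T : Subgroup Γ) ⊓ G :=
      ⟨mul_mem hτ.mem hxT, E.mul_mem_of_notMem hτ.notMem hxG⟩
    have hxe : x = τ * (τ * x) := by rw [← mul_assoc, hτ.mul_self, one_mul]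
    have hs2 : τ * x * (τ * x) = 1 := by
      rw [mul_assoc, ← mul_assoc x, ← (hτ.comm x hxT).eq, mul_assoc,
        hx.mul_self_eq_one hτ.mul_self, mul_one, hτ.mul_self]
    by_cases h1 : τ * x = 1
    · rw [hxe, h1, mul_one]
    · exfalso
      by_cases h2 : τ * x = a ^ N
      · exact E.not_isConj_mul_z hτ (by rwa [← h2, ← hxe])
      · exact hno _ ⟨hs, hs2, h1, h2⟩ (by rwa [← hxe])
  obtain ⟨e, he, hte⟩ := key t ht hcon.1
  obtain ⟨e', he', hte'⟩ := key _ htz hcon.2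
  have hze' : IsNoncentralInvolution ((T : Subgroup Γ) ⊓ G) (a ^ N) (a ^ N * e') := by
    have hc := (E.gens.z_comm he'.1).eq
    refine ⟨mul_mem E.gens.z_mem he'.1, ?_, ?_, ?_⟩
    · rw [mul_assoc, ← mul_assoc e', hc, mul_assoc, he'.2.1, mul_one, E.gens.z_mul_z]
    · intro h
      apply he'.2.2.2
      rw [← mul_one (a ^ N), ← h, ← mul_assoc, E.gens.z_mul_z, one_mul]
    · intro h
      exact he'.2.2.1 (by simpa using h)
  obtain ⟨s, hs, hse⟩ := E.gens.exists_conj_noncentral he hze'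
  refine E.not_isConj_mul_z ht (hte.trans (IsConj.trans ?_ hte'.symm))
  refine isConj_iff.2 ⟨s, ?_⟩
  calc s * (t * e) * s⁻¹ = (s * t) * (e * s⁻¹) := by group
    _ = (t * s) * (e * s⁻¹) := by rw [(ht.comm s hs.1).eq]
    _ = t * (s * e * s⁻¹) := by group
    _ = t * a ^ N * e' := by rw [hse, mul_assoc]

end SemidihedralExtension

end Main

theorem Commute.conj_iff_left {Γ : Type*} [Group Γ] {h x y : Γ} :
    Commute (h * x * h⁻¹) y ↔ Commute x (h⁻¹ * y * h) := by
  constructor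
  · intro H
    have := H.eq
    show _ = _
    calc x * (h⁻¹ * y * h) = h⁻¹ * (h * x * h⁻¹ * y) * h := by group
      _ = h⁻¹ * (y * (h * x * h⁻¹)) * h := by rw [this]
      _ = _ := by group
  · intro H
    have := H.eq
    show _ = _
    calc h * x * h⁻¹ * y = h * (x * (h⁻¹ * y * h)) * h⁻¹ := by group
      _ = h * (h⁻¹ * y * h * x) * h⁻¹ := by rw [this]
      _ = _ := by group

theorem mul_mem_or_of_conj_le {Γ : Type*} [Group Γ] [Finite Γ] {S Q : Subgroup Γ} {w h s : Γ}
    (hw : ∀ x ∈ S, x ∈ Q ∨ x * w ∈ Q) (hconj : ∀ q ∈ Q, h⁻¹ * q * h ∈ S)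
    (hs : s ∈ S) (hsQ : ¬ ∃ q ∈ Q, s = h⁻¹ * q * h) :
    ∀ x ∈ S, ∃ q ∈ Q, x = h⁻¹ * q * h ∨ x = h⁻¹ * q * h * s := by
  classical
  let f : Q ⊕ Q → S := Sum.elim (fun q => ⟨h⁻¹ * q * h, hconj q q.2⟩)
    fun q => ⟨h⁻¹ * q * h * s, mul_mem (hconj q q.2) hs⟩
  let g : S → Q ⊕ Q := fun x =>
    if hx : (x : Γ) ∈ Q then Sum.inl ⟨x, hx⟩ else Sum.inr ⟨x * w, (hw x x.2).resolve_left hx⟩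
  have hg : Function.Injective g := by
    intro x y hxy
    by_cases hx : (x : Γ) ∈ Q <;> by_cases hy : (y : Γ) ∈ Q <;> simp [g, hx, hy] at hxy
    · exact hxy
    · exact hxy
  have hne : ∀ q q' : Q, h⁻¹ * (q : Γ) * h ≠ h⁻¹ * q' * h * s := fun q q' hqq =>
    hsQ ⟨(q' : Γ)⁻¹ * q, mul_mem (inv_mem q'.2) q.2, by
      rw [← inv_mul_eq_iff_eq_mul.2 hqq]; group⟩
  have hf : Function.Injective f := by
    rintro (q | q) (q' | q') hqq
    · have : h⁻¹ * (q : Γ) * h = h⁻¹ * q' * h := congrArg Subtype.val hqq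
      exact congrArg Sum.inl (Subtype.ext (by simpa using this))
    · exact absurd (congrArg Subtype.val hqq) (hne q q')
    · exact absurd (congrArg Subtype.val hqq).symm (hne q' q)
    · have : h⁻¹ * (q : Γ) * h * s = h⁻¹ * q' * h * s := congrArg Subtype.val hqq
      exact congrArg Sum.inr (Subtype.ext (by simpa using this))
  have hsurj := (hf.bijective_of_nat_card_le (Nat.card_le_card_of_injective g hg)).2
  intro x hx
  obtain ⟨q | q, hq⟩ := hsurj ⟨x, hx⟩
  · exact ⟨q, q.2, Or.inl (congrArg Subtype.val hq).symm⟩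
  · exact ⟨q, q.2, Or.inr (congrArg Subtype.val hq).symm⟩

theorem commute_of_mem_closure {Γ : Type*} [Group Γ] {A : Set Γ} {x : Γ}
    (h : ∀ y ∈ A, Commute x y) : ∀ q ∈ Subgroup.closure A, Commute x q := by
  have : Subgroup.closure A ≤ Subgroup.centralizer {x} := by
    rw [Subgroup.closure_le]
    intro y hy
    rw [SetLike.mem_coe, Subgroup.mem_centralizer_singleton_iff]
    exact (h y hy).symm.eq
  intro q hq
  exact (Subgroup.mem_centralizer_singleton_iff.1 (this hq)).symm

namespace SemidihedralExtension

variable {Γ : Type*} [Group Γ] {G : Subgroup Γ} {T : Sylow 2 Γ} {a b : Γ} {N : ℕ} {t : Γ}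

theorem conj_mem_inf (E : SemidihedralExtension G T a b N) {q h : Γ}
    (hq : q ∈ G) (hT : h⁻¹ * q * h ∈ T) : h⁻¹ * q * h ∈ (T : Subgroup Γ) ⊓ G :=
  ⟨hT, by simpa using E.normal.conj_mem q hq h⁻¹⟩

variable [Finite Γ]

theorem commute_of_centric (E : SemidihedralExtension G T a b N)
    (ht : IsOuterCentralInvolution G T t) (hI : IsIsolated t) {Q : Subgroup Γ}
    (hQ : Q ≤ (T : Subgroup Γ) ⊓ G)
    (hcent : ∀ h, (∀ q ∈ Q, h⁻¹ * q * h ∈ T) → ∀ s ∈ (T : Subgroup Γ) ⊓ G,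
      (∀ q ∈ Q, Commute s (h⁻¹ * q * h)) → ∃ q ∈ Q, s = h⁻¹ * q * h) :
    ∀ g ∈ G, (∀ q ∈ Q, Commute g q) → Commute g t := by
  have hQ2 : IsPGroup 2 Q := T.isPGroup'.to_le (hQ.trans inf_le_left)
  have hmem : ∀ g, g ∈ G ⊓ Subgroup.centralizer (Q : Set Γ) ↔
      g ∈ G ∧ ∀ q ∈ Q, Commute g q := by
    intro g
    rw [Subgroup.mem_inf, Subgroup.mem_centralizer_iff]
    exact and_congr_right fun _ => forall₂_congr fun q _ => ⟨Eq.symm, Eq.symm⟩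
  have key := Subgroup.forall_commute_of_forall_conj_commute
    (G ⊓ Subgroup.centralizer (Q : Set Γ)) t (by
    intro g hg
    rw [hmem] at hg
    obtain ⟨h, x, hxT, hxG, h1, h2, h3⟩ := E.exists_lift (hQ.trans inf_le_right) hQ2 hg.1 hg.2
    have hs : t * x ∈ (T : Subgroup Γ) ⊓ G :=
      ⟨mul_mem ht.mem hxT, E.mul_mem_of_notMem ht.notMem hxG⟩
    obtain ⟨q, hq, hsq⟩ := hcent h h1 _ hs fun q hq =>
      (ht.comm _ (h1 q hq)).mul_left (h2 q hq)
    have hth : h * t * h⁻¹ = q * (h * x * h⁻¹)⁻¹ := by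
      have : q = h * (t * x) * h⁻¹ := by rw [hsq]; group
      rw [this]; group
    have hcg : Commute g (h * t * h⁻¹) := by
      rw [hth]; exact (hg.2 q hq).mul_right h3.symm.inv_right
    have htQ : ∀ q ∈ Q, Commute (h * t * h⁻¹) q := fun q hq =>
      Commute.conj_iff_left.2 (ht.comm _ (h1 q hq))
    have htQ' : ∀ q ∈ Q, Commute t q := fun q hq => ht.comm q (hQ hq).1
    obtain ⟨c, hc, hc2⟩ := hI.exists_zpowers_conj ht.mul_self (IsConj.refl t) (isConj_conj h t)
    have hcG : c ∈ G := by
      obtain ⟨i, rfl⟩ := Subgroup.mem_zpowers_iff.1 hc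
      exact zpow_mem (E.mul_mem_of_notMem ht.notMem
        (E.notMem_of_isConj ht.notMem (isConj_conj h t))) i
    refine ⟨c, (hmem c).2 ⟨hcG, fun q hq => ?_⟩, ?_⟩
    · exact (commute_of_mem_zpowers hc ((htQ' q hq).mul_left (htQ q hq)).symm).symm
    · rw [Commute.conj_iff_left]
      have : c⁻¹ * t * c = h * t * h⁻¹ := by
        nth_rw 1 [← hc2]; group
      rwa [this])
  exact fun g hg hgQ => key g ((hmem g).2 ⟨hg, hgQ⟩)

theorem eq_of_centric (E : SemidihedralExtension G T a b N)
    (ht : IsOuterCentralInvolution G T t) (hI : IsIsolated t) {Q : Subgroup Γ}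
    (hQ : Q ≤ (T : Subgroup Γ) ⊓ G)
    (hcent : ∀ h, (∀ q ∈ Q, h⁻¹ * q * h ∈ T) → ∀ s ∈ (T : Subgroup Γ) ⊓ G,
      (∀ q ∈ Q, Commute s (h⁻¹ * q * h)) → ∃ q ∈ Q, s = h⁻¹ * q * h)
    {x : Γ} (hx : IsConj t x) (hxQ : ∀ q ∈ Q, Commute x q) : x = t := by
  have h1 := E.commute_of_centric ht hI hQ hcent (t * x)
    (E.mul_mem_of_notMem ht.notMem (E.notMem_of_isConj ht.notMem hx))
    fun q hq => (ht.comm q (hQ hq).1).mul_left (hxQ q hq)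
  refine hI x hx ?_
  have : x = t⁻¹ * (t * x) := by group
  rw [this]
  exact (Commute.refl t).inv_left.mul_left h1

theorem eq_of_commute_noncentral (E : SemidihedralExtension G T a b N)
    (ht : IsOuterCentralInvolution G T t) (hI : IsIsolated t) {e : Γ}
    (he : IsNoncentralInvolution ((T : Subgroup Γ) ⊓ G) (a ^ N) e) {x : Γ} (hx : IsConj t x)
    (hxz : Commute x (a ^ N)) (hxe : Commute x e) : x = t := by
  have D := E.gens
  have hzS := D.z_mem
  have hez := (D.z_comm he.1).eq
  set Q : Subgroup Γ := Subgroup.closure {a ^ N, e} with hQdef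
  have hzQ : a ^ N ∈ Q := Subgroup.subset_closure (by simp)
  have heQ : e ∈ Q := Subgroup.subset_closure (by simp)
  have hQS : Q ≤ (T : Subgroup Γ) ⊓ G := by
    rw [hQdef, Subgroup.closure_le]
    rintro y (rfl | rfl)
    · exact hzS
    · exact he.1
  refine E.eq_of_centric ht hI hQS ?_ hx ?_
  · intro h h1 s hs hsc
    -- a conjugate of the four-group contains a noncentral involution
    have hconj : ∀ q ∈ Q, q * q = 1 → q ≠ 1 → h⁻¹ * q * h ≠ a ^ N →
        IsNoncentralInvolution ((T : Subgroup Γ) ⊓ G) (a ^ N) (h⁻¹ * q * h) := by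
      intro q hq hq2 hq1 hqz
      refine ⟨E.conj_mem_inf (hQS hq).2 (h1 q hq), ?_, ?_, hqz⟩
      · calc h⁻¹ * q * h * (h⁻¹ * q * h) = h⁻¹ * (q * q) * h := by group
          _ = 1 := by rw [hq2]; group
      · intro h2
        apply hq1
        calc q = h * (h⁻¹ * q * h) * h⁻¹ := by group
          _ = 1 := by rw [h2]; group
    -- two distinct involutions of `Q`, one of them conjugate to `z`
    have hmain : ∀ q q' : Γ, q ∈ Q → q' ∈ Q → q * q = 1 → q ≠ 1 → h⁻¹ * q * h ≠ a ^ N →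
        h⁻¹ * q' * h = a ^ N → ∃ q ∈ Q, s = h⁻¹ * q * h := by
      intro q q' hq hq' hq2 hq1 hqz hq'z
      rcases D.eq_of_commute_noncentral (hconj q hq hq2 hq1 hqz) hs (hsc q hq) with
        h2 | h2 | h2 | h2
      · exact ⟨1, one_mem _, by rw [h2]; group⟩
      · exact ⟨q', hq', by rw [h2, hq'z]⟩
      · exact ⟨q, hq, h2⟩
      · exact ⟨q * q', mul_mem hq hq', by rw [h2, ← hq'z]; group⟩
    have hinj : ∀ q q' : Γ, h⁻¹ * q * h = h⁻¹ * q' * h → q = q' := fun q q' hqq => by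
      simpa using hqq
    by_cases hz : h⁻¹ * a ^ N * h = a ^ N
    · exact hmain e (a ^ N) heQ hzQ he.2.1 he.2.2.1
        (fun h2 => he.2.2.2 (hinj _ _ (h2.trans hz.symm))) hz
    by_cases hez' : h⁻¹ * e * h = a ^ N
    · exact hmain (a ^ N) e hzQ heQ D.z_mul_z D.z_ne_one hz hez'
    refine hmain e (a ^ N * e) heQ (mul_mem hzQ heQ) he.2.1 he.2.2.1 hez' ?_
    have hzn := hconj _ hzQ D.z_mul_z D.z_ne_one hz
    have hen := hconj _ heQ he.2.1 he.2.2.1 hez'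
    have hc : Commute (h⁻¹ * e * h) (h⁻¹ * a ^ N * h) := by
      show _ = _
      calc h⁻¹ * e * h * (h⁻¹ * a ^ N * h) = h⁻¹ * (e * a ^ N) * h := by group
        _ = h⁻¹ * (a ^ N * e) * h := by rw [hez]
        _ = _ := by group
    rcases D.eq_of_commute_noncentral hzn hen.1 hc with h2 | h2 | h2 | h2
    · exact absurd h2 hen.2.2.1
    · exact absurd h2 hen.2.2.2
    · exact absurd (hinj _ _ h2) he.2.2.2
    · calc h⁻¹ * (a ^ N * e) * h = h⁻¹ * a ^ N * h * (h⁻¹ * e * h) := by group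
        _ = a ^ N := by rw [h2, ← mul_assoc, hzn.2.1, one_mul]
  · refine commute_of_mem_closure ?_
    rintro y (rfl | rfl)
    · exact hxz
    · exact hxe

theorem eq_of_commute_index_two (E : SemidihedralExtension G T a b N)
    (ht : IsOuterCentralInvolution G T t) (hI : IsIsolated t) {Q : Subgroup Γ}
    (hQ : Q ≤ (T : Subgroup Γ) ⊓ G) {w c : Γ}
    (hw : ∀ x ∈ (T : Subgroup Γ) ⊓ G, x ∈ Q ∨ x * w ∈ Q) (hcQ : c ∈ Q) (hc1 : c ≠ 1)
    (hcc : ∀ q ∈ Q, Commute c q) {x : Γ} (hx : IsConj t x) (hxQ : ∀ q ∈ Q, Commute x q) :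
    x = t := by
  refine E.eq_of_centric ht hI hQ ?_ hx hxQ
  intro h h1 s hs hsc
  by_contra hsQ
  have hcov := mul_mem_or_of_conj_le hw (fun q hq => E.conj_mem_inf (hQ hq).2 (h1 q hq)) hs hsQ
  have hcen : ∀ y : Γ, y ∈ (T : Subgroup Γ) ⊓ G → (∀ q ∈ Q, Commute y (h⁻¹ * q * h)) →
      Commute y s → y = 1 ∨ y = a ^ N := by
    intro y hy hyQ hys
    refine E.gens.eq_of_forall_commute hy fun x hx => ?_
    obtain ⟨q, hq, rfl | rfl⟩ := hcov x hx
    · exact hyQ q hq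
    · exact (hyQ q hq).mul_right hys
  have hcS : h⁻¹ * c * h ∈ (T : Subgroup Γ) ⊓ G := E.conj_mem_inf (hQ hcQ).2 (h1 c hcQ)
  have hc := hcen _ hcS (fun q hq => by
    have := (hcc q hq).eq
    show _ = _
    calc h⁻¹ * c * h * (h⁻¹ * q * h) = h⁻¹ * (c * q) * h := by group
      _ = h⁻¹ * (q * c) * h := by rw [this]
      _ = _ := by group) (hsc c hcQ).symm
  have hc' := hc.resolve_left fun h2 => hc1 (by
    calc c = h * (h⁻¹ * c * h) * h⁻¹ := by group
      _ = 1 := by rw [h2]; group)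
  rcases hcen s hs hsc (Commute.refl s) with h2 | h2
  · exact hsQ ⟨1, one_mem _, by rw [h2]; group⟩
  · exact hsQ ⟨c, hcQ, by rw [h2, hc']⟩

end SemidihedralExtension

namespace SemidihedralExtension

variable {Γ : Type*} [Group Γ] [Finite Γ] {G : Subgroup Γ} {T : Sylow 2 Γ} {a b : Γ} {N : ℕ}
  {t : Γ}

theorem eq_of_commute_a (E : SemidihedralExtension G T a b N)
    (ht : IsOuterCentralInvolution G T t) (hI : IsIsolated t) {x : Γ} (hx : IsConj t x)
    (hxa : Commute x a) : x = t := by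
  have D := E.gens
  refine E.eq_of_commute_index_two ht hI (Q := Subgroup.zpowers a) (w := b) (c := a ^ N)
    (by rw [Subgroup.zpowers_le]; exact D.a_mem) ?_ (Subgroup.npow_mem_zpowers a N) D.z_ne_one
    (fun q hq => commute_of_mem_zpowers hq (Commute.pow_self a N)) hx
    fun q hq => commute_of_mem_zpowers hq hxa
  intro y hy
  obtain ⟨i, rfl | rfl⟩ := D.cover y hy
  · exact Or.inl (Subgroup.zpow_mem_zpowers a i)
  · right
    rw [mul_assoc, D.b_mul_b, mul_one]
    exact Subgroup.zpow_mem_zpowers a i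

theorem eq_of_commute_a_sq (E : SemidihedralExtension G T a b N)
    (ht : IsOuterCentralInvolution G T t) (hI : IsIsolated t) {x : Γ} (hx : IsConj t x)
    (hxa : Commute x (a ^ 2)) (hxb : Commute x (a * b)) : x = t := by
  have D := E.gens
  set Q : Subgroup Γ := Subgroup.closure {a ^ 2, a * b} with hQ
  have hsq : ∀ k : ℤ, a ^ (2 * k) ∈ Q := fun k => by
    rw [zpow_mul]
    exact zpow_mem (Subgroup.subset_closure (by norm_cast; simp)) k
  have hodd : ∀ k : ℤ, a ^ (2 * k + 1) * b ∈ Q := fun k => by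
    rw [zpow_add, zpow_one, mul_assoc]
    exact mul_mem (hsq k) (Subgroup.subset_closure (by simp))
  have hQS : Q ≤ (T : Subgroup Γ) ⊓ G := by
    rw [hQ, Subgroup.closure_le]
    rintro y (rfl | rfl)
    · exact pow_mem D.a_mem 2
    · exact mul_mem D.a_mem D.b_mem
  refine E.eq_of_commute_index_two ht hI (Q := Q) (w := b) (c := a ^ N) hQS ?_ ?_ D.z_ne_one
    (fun q hq => (D.z_comm (hQS hq)).symm) hx ?_
  · intro y hy
    obtain ⟨i, rfl | rfl⟩ := D.cover y hy <;> obtain ⟨k, rfl | rfl⟩ := Int.even_or_odd' i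
    · exact Or.inl (hsq k)
    · exact Or.inr (hodd k)
    · right
      rw [mul_assoc, D.b_mul_b, mul_one]
      exact hsq k
    · exact Or.inl (hodd k)
  · obtain ⟨M, hM⟩ := D.four_dvd
    have := hsq (2 * M)
    rw [hM, ← zpow_natCast]
    convert this using 2
    push_cast; ring
  · refine commute_of_mem_closure ?_
    rintro y (rfl | rfl)
    · exact hxa
    · exact hxb

theorem eq_of_commute_z (E : SemidihedralExtension G T a b N)
    (ht : IsOuterCentralInvolution G T t) (hI : IsIsolated t) {x : Γ} (hx : IsConj t x)
    (hxz : Commute x (a ^ N)) : x = t := by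
  have D := E.gens
  have htS : ∀ s ∈ (T : Subgroup Γ) ⊓ G, Commute s t := fun s hs => (ht.comm s hs.1).symm
  have hnc : ∀ e, IsNoncentralInvolution ((T : Subgroup Γ) ⊓ G) (a ^ N) e →
      Commute x (t * e) := by
    intro e he
    refine hI.commute_mul_of_normalizes ht.mul_self (Subgroup.centralizer {a ^ N})
      ?_ hx ?_ ?_ ?_
    · intro y hy
      have he' : e ∈ Subgroup.centralizer {a ^ N} :=
        Subgroup.mem_centralizer_singleton_iff.2 (D.z_comm he.1)
      exact mul_mem (mul_mem he' hy) (inv_mem he')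
    · exact Subgroup.mem_centralizer_singleton_iff.2 hxz
    · rw [he.2.1]; exact Commute.one_left x
    · intro y hy hyz hye
      exact E.eq_of_commute_noncentral ht hI he hy
        (Subgroup.mem_centralizer_singleton_iff.1 hyz) hye
  have hb := hnc _ D.isNoncentralInvolution_b
  have ha2b : Commute x (t * (a ^ 2 * b)) := by
    refine hnc _ ?_
    simpa using D.isNoncentralInvolution_zpow_mul_b 1
  have hbt := (htS b D.b_mem).eq
  have hxa2 : Commute x (a ^ 2) := by
    have : a ^ 2 = (t * (a ^ 2 * b)) * (t * b) := by
      rw [← hbt, mul_assoc, mul_assoc, ← mul_assoc b, D.b_mul_b, one_mul,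
        (htS _ (pow_mem D.a_mem 2)).eq, ← mul_assoc, ht.mul_self, one_mul]
    rw [this]
    exact ha2b.mul_right hb
  have hxa : Commute x (t * a) := by
    refine hI.commute_mul_of_normalizes ht.mul_self (Subgroup.centralizer {a ^ 2})
      ?_ hx ?_ ?_ ?_
    · intro y hy
      have ha' : a ∈ Subgroup.centralizer {a ^ 2} :=
        Subgroup.mem_centralizer_singleton_iff.2 (Commute.self_pow a 2)
      exact mul_mem (mul_mem ha' hy) (inv_mem ha')
    · exact Subgroup.mem_centralizer_singleton_iff.2 hxa2
    · rw [← pow_two]; exact hxa2.symm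
    · exact fun y hy _ hya => E.eq_of_commute_a ht hI hy hya
  refine E.eq_of_commute_a_sq ht hI hx hxa2 ?_
  have : a * b = (t * a) * (t * b) := by
    rw [mul_assoc, ← mul_assoc a, (htS a D.a_mem).eq, mul_assoc, ← mul_assoc, ht.mul_self, one_mul]
  rw [this]
  exact hxa.mul_right hb

theorem forall_isConj_eq (E : SemidihedralExtension G T a b N)
    (ht : IsOuterCentralInvolution G T t) (hI : IsIsolated t)
    (hb : ∀ x, IsConj t x → Commute x b → x = t) : ∀ x, IsConj t x → x = t := by
  have D := E.gens
  intro x hx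
  have hbz : ∀ y, IsConj t y → Commute y (b * a ^ N) → y = t := by
    intro y hy hyb
    obtain ⟨s, hs, hse⟩ := D.exists_conj_noncentral D.isNoncentralInvolution_b
      D.isNoncentralInvolution_b_mul_z
    have h1 : s⁻¹ * y * s = t := by
      refine hb _ (hy.trans (isConj_iff.2 ⟨s⁻¹, by simp⟩)) ?_
      rw [← hse] at hyb
      exact (Commute.conj_iff_left.1 hyb.symm).symm
    have h2 := (ht.comm s hs.1).eq
    calc y = s * (s⁻¹ * y * s) * s⁻¹ := by group
      _ = t := by rw [h1, ← h2]; group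
  have hnc : ∀ e, IsNoncentralInvolution ((T : Subgroup Γ) ⊓ G) (a ^ N) e →
      (∀ y, IsConj t y → Commute y e → y = t) → Commute x (t * e) := by
    intro e he hu
    refine hI.commute_mul_of_normalizes ht.mul_self ⊤ (fun _ _ => Subgroup.mem_top _) hx
      (Subgroup.mem_top _) ?_ fun y hy _ hye => hu y hy hye
    rw [he.2.1]; exact Commute.one_left x
  have h1 := hnc b D.isNoncentralInvolution_b hb
  have h2 := hnc _ D.isNoncentralInvolution_b_mul_z hbz
  refine E.eq_of_commute_z ht hI hx ?_
  have : a ^ N = (t * b) * (t * (b * a ^ N)) := by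
    rw [mul_assoc, ← mul_assoc b t, ← (ht.comm b D.b_mem.1).eq, mul_assoc, ← mul_assoc b,
      D.b_mul_b, one_mul, ← mul_assoc, ht.mul_self, one_mul]
  rw [this]
  exact h1.mul_right h2

theorem eq_of_commute_b_of_isConj (E : SemidihedralExtension G T a b N)
    (ht : IsOuterCentralInvolution G T t) (hI : IsIsolated t) (hzb : IsConj (a ^ N) b)
    {x : Γ} (hx : IsConj t x) (hxb : Commute x b) : x = t := by
  obtain ⟨g, hg⟩ := isConj_iff.1 hzb
  have key : ∀ y, IsConj t y → Commute y b → y = g * t * g⁻¹ := by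
    intro y hy hyb
    have h1 : g⁻¹ * y * g = t := by
      refine E.eq_of_commute_z ht hI (hy.trans (isConj_iff.2 ⟨g⁻¹, by simp⟩)) ?_
      rw [← hg] at hyb
      exact (Commute.conj_iff_left.1 hyb.symm).symm
    rw [← h1]; group
  rw [key x hx hxb, ← key t (IsConj.refl t) (ht.comm b E.gens.b_mem.1)]

theorem isIsolated_mul_z (E : SemidihedralExtension G T a b N)
    (ht : IsOuterCentralInvolution G T t) (hI : IsIsolated t) (hzb : ¬ IsConj (a ^ N) b) :
    IsIsolated (t * a ^ N) := by
  have D := E.gens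
  have htz := E.isOuterCentralInvolution_mul_z ht
  refine E.isIsolated_of_forall_mem htz fun x hx hxT => ?_
  have hxG := E.notMem_of_isConj htz.notMem hx
  have hs : t * x ∈ (T : Subgroup Γ) ⊓ G :=
    ⟨mul_mem ht.mem hxT, E.mul_mem_of_notMem ht.notMem hxG⟩
  have hxe : x = t * (t * x) := by rw [← mul_assoc, ht.mul_self, one_mul]
  have hs2 : t * x * (t * x) = 1 := by
    rw [mul_assoc, ← mul_assoc x, ← (ht.comm x hxT).eq, mul_assoc,
      hx.mul_self_eq_one htz.mul_self, mul_one, ht.mul_self]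
  by_cases h2 : t * x = a ^ N
  · rw [hxe, h2]
  exfalso
  by_cases h1 : t * x = 1
  · rw [hxe, h1, mul_one] at hx
    exact E.not_isConj_mul_z ht hx.symm
  obtain ⟨s, hs, hsb⟩ := D.exists_conj_noncentral ⟨hs, hs2, h1, h2⟩ D.isNoncentralInvolution_b
  have hconj : IsConj (t * a ^ N) (t * b) := by
    refine hx.trans (isConj_iff.2 ⟨s, ?_⟩)
    nth_rw 1 [hxe]
    calc s * (t * (t * x)) * s⁻¹ = (s * t) * (t * x) * s⁻¹ := by group
      _ = t * (s * (t * x) * s⁻¹) := by rw [← (ht.comm s hs.1).eq]; group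
      _ = t * b := by rw [hsb]
  obtain ⟨g, hg⟩ := isConj_iff.1 hconj
  have hgc : Commute (g * t * g⁻¹) (t * b) := by
    rw [← hg, Commute.conj_iff_left]
    have : g⁻¹ * (g * (t * a ^ N) * g⁻¹) * g = t * a ^ N := by group
    rw [this]
    exact ht.comm _ htz.mem
  obtain ⟨c, hc, hc2⟩ := hI.exists_zpowers_conj ht.mul_self (IsConj.refl t) (isConj_conj g t)
  have hcb : Commute (t * b) c := commute_of_mem_zpowers hc
    ((ht.comm _ (mul_mem ht.mem D.b_mem.1)).mul_left hgc).symm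
  apply hzb
  refine isConj_iff.2 ⟨c * g, ?_⟩
  have h3 : t * (c * g * a ^ N * (c * g)⁻¹) = t * b := by
    calc t * (c * g * a ^ N * (c * g)⁻¹)
        = (c * (g * t * g⁻¹) * c⁻¹) * (c * g * a ^ N * (c * g)⁻¹) := by rw [hc2]
      _ = c * (g * (t * a ^ N) * g⁻¹) * c⁻¹ := by group
      _ = t * b := by rw [hg, ← hcb.eq]; group
  exact mul_left_cancel h3

theorem commute_of_isConj_of_isConj_mul_z (E : SemidihedralExtension G T a b N)
    (ht : IsOuterCentralInvolution G T t) (hI : IsIsolated t) {x y : Γ} (hx : IsConj t x)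
    (hy : IsConj (t * a ^ N) y) : Commute x y := by
  have key : ∀ x, IsConj t x → Commute x (t * a ^ N) := by
    intro x hx
    refine hI.commute_mul_of_normalizes ht.mul_self ⊤ (fun _ _ => Subgroup.mem_top _) hx
      (Subgroup.mem_top _) ?_ fun y hy _ hye => E.eq_of_commute_z ht hI hy hye
    rw [E.gens.z_mul_z]; exact Commute.one_left x
  obtain ⟨g, rfl⟩ := isConj_iff.1 hy
  refine (Commute.conj_iff_left.2 ?_).symm
  exact (key _ (hx.trans (isConj_iff.2 ⟨g⁻¹, by simp⟩))).symm

theorem commute_b_dichotomy (E : SemidihedralExtension G T a b N)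
    (ht : IsOuterCentralInvolution G T t) (hI : IsIsolated t) (hzb : ¬ IsConj (a ^ N) b) :
    (∀ x, IsConj t x → Commute x b → x = t) ∨
      ∀ x, IsConj (t * a ^ N) x → Commute x b → x = t * a ^ N := by
  by_contra! hcon
  obtain ⟨⟨x₁, hx₁, hx₁b, hne₁⟩, x₂, hx₂, hx₂b, hne₂⟩ := hcon
  have D := E.gens
  have htz := E.isOuterCentralInvolution_mul_z ht
  have hIz := E.isIsolated_mul_z ht hI hzb
  have hcomm : ∀ {x y : Γ}, IsConj t x → IsConj (t * a ^ N) y → Commute x y :=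
    fun hx hy => E.commute_of_isConj_of_isConj_mul_z ht hI hx hy
  have hne : ∀ {τ x : Γ}, IsOuterCentralInvolution G T τ → τ * x = 1 → x = τ := by
    intro τ x hτ h
    rw [← mul_right_inj τ, h, hτ.mul_self]
  have hinv : ∀ {τ x : Γ}, IsOuterCentralInvolution G T τ → IsConj τ x →
      τ * (τ * x) * τ⁻¹ = (τ * x)⁻¹ := by
    intro τ x hτ hx
    rw [← mul_assoc, hτ.mul_self, one_mul, mul_inv_rev,
      inv_eq_of_mul_eq_one_left (hx.mul_self_eq_one hτ.mul_self)]
  set τ := t * a ^ N with hτ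
  have hbQ : ∀ q ∈ Subgroup.zpowers b, Commute (t * x₁ * (τ * x₂)) q := fun q hq =>
    commute_of_mem_zpowers hq
      (((ht.comm b D.b_mem.1).mul_left hx₁b).mul_left ((htz.comm b D.b_mem.1).mul_left hx₂b))
  obtain ⟨h, x, hxT, hxG, h1, h2, h3⟩ := E.exists_lift (Q := Subgroup.zpowers b)
    (by rw [Subgroup.zpowers_le]; exact D.b_mem.2) (isPGroup_two_zpowers_of_mul_self D.b_mul_b)
    (mul_mem (E.mul_mem_of_notMem ht.notMem (E.notMem_of_isConj ht.notMem hx₁))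
      (E.mul_mem_of_notMem htz.notMem (E.notMem_of_isConj htz.notMem hx₂))) hbQ
  have hbb := Subgroup.mem_zpowers b
  have he : IsNoncentralInvolution ((T : Subgroup Γ) ⊓ G) (a ^ N) (h⁻¹ * b * h) := by
    refine ⟨E.conj_mem_inf D.b_mem.2 (h1 b hbb), ?_, ?_, ?_⟩
    · calc h⁻¹ * b * h * (h⁻¹ * b * h) = h⁻¹ * (b * b) * h := by group
        _ = 1 := by rw [D.b_mul_b]; group
    · intro h4
      refine D.isNoncentralInvolution_b.2.2.1 ?_
      calc b = h * (h⁻¹ * b * h) * h⁻¹ := by group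
        _ = 1 := by rw [h4]; group
    · intro h4
      exact hzb (isConj_iff.2 ⟨h, by rw [← h4]; group⟩)
  set e := h⁻¹ * b * h with hedef
  have hs : t * x ∈ (T : Subgroup Γ) ⊓ G :=
    ⟨mul_mem ht.mem hxT, E.mul_mem_of_notMem ht.notMem hxG⟩
  have hxe : x = t * (t * x) := by rw [← mul_assoc, ht.mul_self, one_mul]
  have hse : Commute (t * x) e := (ht.comm _ he.1.1).mul_left (h2 b hbb)
  have hbn : Commute (h * e * h⁻¹) (t * x₁ * (τ * x₂)) := by
    have : h * e * h⁻¹ = b := by rw [hedef]; group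
    rw [this]
    exact (hbQ b hbb).symm
  -- a conjugate of `t` or of `τ` commutes with both `t * x₁` and `τ * x₂`
  have hA : ¬ Commute (h * t * h⁻¹) (t * x₁ * (τ * x₂)) := by
    intro hc
    have hy := isConj_conj h t
    have hc2 : Commute (h * t * h⁻¹) (τ * x₂) :=
      (hcomm hy (IsConj.refl _)).mul_right (hcomm hy hx₂)
    have hc1 : Commute (h * t * h⁻¹) (t * x₁) := by
      have := hc.mul_right hc2.inv_right
      rwa [mul_inv_cancel_right] at this
    exact hne₁ (hne ht (hI.eq_one_of_inverted ht.mul_self hy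
      (odd_orderOf_mul_of_isIsolated ht.mul_self hI (IsConj.refl t) hx₁) hc1 (hinv ht hx₁)))
  have hB : ¬ Commute (h * τ * h⁻¹) (t * x₁ * (τ * x₂)) := by
    intro hc
    have hy := isConj_conj h τ
    have hc1 : Commute (h * τ * h⁻¹) (t * x₁) :=
      (hcomm (IsConj.refl _) hy).symm.mul_right (hcomm hx₁ hy).symm
    have hc2 : Commute (h * τ * h⁻¹) (τ * x₂) := by
      have := hc1.inv_right.mul_right hc
      rwa [inv_mul_cancel_left] at this
    exact hne₂ (hne htz (hIz.eq_one_of_inverted htz.mul_self hy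
      (odd_orderOf_mul_of_isIsolated htz.mul_self hIz (IsConj.refl τ) hx₂) hc2 (hinv htz hx₂)))
  have hstrip : ∀ y : Γ, Commute (h * (y * e) * h⁻¹) (t * x₁ * (τ * x₂)) →
      Commute (h * y * h⁻¹) (t * x₁ * (τ * x₂)) := by
    intro y hy
    have h5 := hy.mul_left hbn.inv_left
    have : h * (y * e) * h⁻¹ * (h * e * h⁻¹)⁻¹ = h * y * h⁻¹ := by group
    rwa [this] at h5
  rcases D.eq_of_commute_noncentral he hs hse with h4 | h4 | h4 | h4
  · rw [hxe, h4, mul_one] at h3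
    exact hA h3
  · rw [hxe, h4] at h3
    exact hB h3
  · rw [hxe, h4] at h3
    exact hA (hstrip _ h3)
  · rw [hxe, h4, (D.z_comm he.1).eq, ← mul_assoc t] at h3
    exact hB (hstrip _ h3)

theorem central_or_central_mul_z (E : SemidihedralExtension G T a b N)
    (ht : IsOuterCentralInvolution G T t) :
    (∀ g, Commute g t) ∨ ∀ g, Commute g (t * a ^ N) := by
  have hcen : ∀ {τ : Γ}, (∀ x, IsConj τ x → x = τ) → ∀ g, Commute g τ := by
    intro τ h g
    have := h _ (isConj_conj g τ)
    rwa [mul_inv_eq_iff_eq_mul] at this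
  have main : ∀ {t : Γ}, IsOuterCentralInvolution G T t → IsIsolated t →
      (∀ g, Commute g t) ∨ ∀ g, Commute g (t * a ^ N) := by
    intro t ht hI
    by_cases hzb : IsConj (a ^ N) b
    · exact Or.inl (hcen (E.forall_isConj_eq ht hI fun x hx hxb =>
        E.eq_of_commute_b_of_isConj ht hI hzb hx hxb))
    · exact (E.commute_b_dichotomy ht hI hzb).imp
        (fun h => hcen (E.forall_isConj_eq ht hI h))
        fun h => hcen (E.forall_isConj_eq (E.isOuterCentralInvolution_mul_z ht)
          (E.isIsolated_mul_z ht hI hzb) h)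
  rcases E.isIsolated_or ht with hI | hI
  · exact main ht hI
  · have := main (E.isOuterCentralInvolution_mul_z ht) hI
    rw [mul_assoc, E.gens.z_mul_z, mul_one] at this
    exact this.symm

end SemidihedralExtension

section Parity

theorem sum_coeff_mul {R G : Type*} [Semiring R] [Group G] [Fintype G]
    (x y : MonoidAlgebra R G) (P : G → Prop) [DecidablePred P] :
    ∑ g with P g, (x * y).coeff g =
      ∑ p : G × G with P (p.1 * p.2), x.coeff p.1 * y.coeff p.2 := by
  classical
  have h : ∀ g, (x * y).coeff g =
      ∑ p : G × G, if p.1 * p.2 = g then x.coeff p.1 * y.coeff p.2 else 0 := by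
    intro g
    rw [MonoidAlgebra.coeff_mul_antidiag x y g (Finset.univ.filter fun p => p.1 * p.2 = g)
      (by simp), Finset.sum_filter]
  simp_rw [h]
  rw [Finset.sum_comm, Finset.sum_filter]
  refine Finset.sum_congr rfl fun p _ => ?_
  rw [Finset.sum_ite_eq]
  simp

theorem IsPGroup.sum_eq_sum_fixed {H Ω : Type*} [Group H] [Fintype Ω] (hH : IsPGroup 2 H)
    (σ : H → Ω → Ω) (h_one : ∀ x, σ 1 x = x) (h_mul : ∀ h k x, σ (h * k) x = σ h (σ k x))
    (F : Ω → ZMod 2) (hF : ∀ h x, F (σ h x) = F x) [DecidablePred fun x => ∀ h, σ h x = x] :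
    ∑ x, F x = ∑ x with ∀ h, σ h x = x, F x := by
  classical
  let _ : MulAction H {x : Ω // F x = 1} :=
    { smul := fun h x => ⟨σ h x.1, (hF h x.1).trans x.2⟩
      one_smul := fun x => Subtype.ext (h_one x.1)
      mul_smul := fun h k x => Subtype.ext (h_mul h k x.1) }
  have hcard : ∀ p : Ω → Prop, [DecidablePred p] → ∑ x with p x, F x =
      (Nat.card {x : {x : Ω // F x = 1} // p x.1} : ZMod 2) := by
    intro p _
    have h01 : ∀ c : ZMod 2, c = if c = 1 then 1 else 0 := by decide
    rw [Finset.sum_congr rfl fun x _ => h01 (F x), ← Finset.sum_filter, Finset.filter_filter,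
      Finset.sum_const, nsmul_one, Nat.card_congr (Equiv.subtypeSubtypeEquivSubtypeInter _ _),
      Nat.card_eq_fintype_card, Fintype.card_subtype]
    simp [and_comm]
  have h1 := hcard (fun _ => True)
  have h2 := hcard (fun x => ∀ h, σ h x = x)
  have h3 := hH.card_modEq_card_fixedPoints {x : Ω // F x = 1}
  rw [← ZMod.natCast_eq_natCast_iff] at h3
  rw [h2, ← Finset.filter_true (s := Finset.univ (α := Ω)), h1]
  rw [Nat.card_congr (Equiv.subtypeUnivEquiv fun _ => trivial), h3]
  congr 1
  refine Nat.card_congr (Equiv.subtypeEquivRight fun x => ?_)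
  rw [MulAction.mem_fixedPoints]
  exact forall_congr' fun h => Subtype.ext_iff

open Classical in
theorem exists_twisted_centralizer {G : Type*} [Group G] [Finite G] {U V : MonoidAlgebra (ZMod 2) G}
    (hUV : U * V = 1) (hVU : V * U = 1) (φ : G →* G)
    (hU : ∀ g, MonoidAlgebra.of (ZMod 2) G g * U = U * MonoidAlgebra.of (ZMod 2) G (φ g))
    {Q : Subgroup G} (hQ : IsPGroup 2 Q) {n : G} (hn : ∀ q ∈ Q, Commute n q) :
    ∃ x, (∀ q ∈ Q, q * x = x * φ q) ∧ n * x = x * φ n := by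
  have : Fintype G := Fintype.ofFinite G
  have hV : ∀ g, MonoidAlgebra.of (ZMod 2) G (φ g) * V = V * MonoidAlgebra.of (ZMod 2) G g := by
    intro g
    calc _ = V * U * MonoidAlgebra.of (ZMod 2) G (φ g) * V := by rw [hVU, one_mul]
      _ = V * (U * MonoidAlgebra.of (ZMod 2) G (φ g)) * V := by simp only [mul_assoc]
      _ = V * MonoidAlgebra.of (ZMod 2) G g * (U * V) := by rw [← hU]; simp only [mul_assoc]
      _ = _ := by rw [hUV, mul_one]
  have hf : ∀ q x, U.coeff (q * x * (φ q)⁻¹) = U.coeff x := by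
    intro q x
    have h := congrArg (fun w => w.coeff (q * x)) (hU q)
    simp only [MonoidAlgebra.of_apply, MonoidAlgebra.coeff_single_mul_apply,
      MonoidAlgebra.coeff_mul_single_apply, one_mul, mul_one, inv_mul_cancel_left] at h
    exact h.symm
  have hf' : ∀ q y, V.coeff (φ q * y * q⁻¹) = V.coeff y := by
    intro q y
    have h := congrArg (fun w => w.coeff (φ q * y)) (hV q)
    simp only [MonoidAlgebra.of_apply, MonoidAlgebra.coeff_single_mul_apply,
      MonoidAlgebra.coeff_mul_single_apply, one_mul, mul_one, inv_mul_cancel_left] at h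
    exact h.symm
  let K : G → Prop := fun g => ∃ c, (∀ q ∈ Q, Commute c q) ∧ g = c * n * c⁻¹
  have hKn : K n := ⟨1, fun q _ => Commute.one_left q, by simp⟩
  have hKQ : ∀ q ∈ Q, ∀ g, K g → q * g * q⁻¹ = g := by
    rintro q hq _ ⟨c, hc, rfl⟩
    have h : Commute (c * n * c⁻¹) q := ((hc q hq).mul_left (hn q hq)).mul_left (hc q hq).inv_left
    rw [← h.eq, mul_inv_cancel_right]
  have hKQ' : ∀ q ∈ Q, ∀ g, K (q * g * q⁻¹) ↔ K g := by
    refine fun q hq g => ⟨fun h => ?_, fun h => (hKQ q hq g h).symm ▸ h⟩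
    have h' := hKQ q⁻¹ (Q.inv_mem hq) _ h
    rw [show q⁻¹ * (q * g * q⁻¹) * q⁻¹⁻¹ = g by group] at h'
    exact h'.symm ▸ h
  have hKC : ∀ d, (∀ q ∈ Q, Commute d q) → ∀ g, K g → K (d * g * d⁻¹) := by
    rintro d hd _ ⟨c, hc, rfl⟩
    exact ⟨d * c, fun q hq => (hd q hq).mul_left (hc q hq), by group⟩
  have hKC' : ∀ d, (∀ q ∈ Q, Commute d q) → ∀ g, K (d * g * d⁻¹) ↔ K g := by
    refine fun d hd g => ⟨fun h => ?_, hKC d hd g⟩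
    have h' := hKC d⁻¹ (fun q hq => (hd q hq).inv_left) _ h
    rwa [show d⁻¹ * (d * g * d⁻¹) * d⁻¹⁻¹ = g by group] at h'
  let σ : Q → G × G → G × G := fun q p => (q * p.1 * (φ q)⁻¹, φ q * p.2 * (q : G)⁻¹)
  have σ_one : ∀ p, σ 1 p = p := fun p => by simp [σ]
  have σ_mul : ∀ h k p, σ (h * k) p = σ h (σ k p) := fun h k p => by
    simp [σ, mul_assoc]
  have hfix : ∀ p, (∀ q, σ q p = p) → ∀ q ∈ Q, q * p.1 = p.1 * φ q ∧ φ q * p.2 = p.2 * q := by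
    intro p hp q hq
    have h := hp ⟨q, hq⟩
    exact ⟨mul_inv_eq_iff_eq_mul.1 (congrArg Prod.fst h),
      mul_inv_eq_iff_eq_mul.1 (congrArg Prod.snd h)⟩
  have h1 : ∑ p : G × G, (if K (p.1 * φ n * p.2) then U.coeff p.1 * V.coeff p.2 else 0) = 1 := by
    have h := sum_coeff_mul (U * MonoidAlgebra.of (ZMod 2) G (φ n)) V K
    rw [← hU, mul_assoc, hUV, mul_one] at h
    simp only [Finset.sum_filter, MonoidAlgebra.of_apply, MonoidAlgebra.coeff_single,
      Finsupp.single_apply] at h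
    rw [Finset.sum_eq_single n (by intro b _ hb; simp [hb.symm]) (by simp), if_pos hKn,
      if_pos rfl] at h
    rw [h]
    refine Fintype.sum_equiv ((Equiv.mulRight (φ n)).prodCongr (Equiv.refl G)) _ _ fun p => ?_
    have h' := hf n (n⁻¹ * (p.1 * φ n))
    rw [mul_inv_cancel_left, mul_inv_cancel_right] at h'
    simp [h']
  rw [hQ.sum_eq_sum_fixed σ σ_one σ_mul] at h1
  swap
  · rintro ⟨q, hq⟩ p
    have h : q * p.1 * (φ q)⁻¹ * φ n * (φ q * p.2 * q⁻¹) = q * (p.1 * φ n * p.2) * q⁻¹ := by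
      have h' := congrArg φ (hn q hq).eq
      simp only [map_mul] at h'
      calc _ = q * p.1 * (φ q)⁻¹ * (φ n * φ q) * p.2 * q⁻¹ := by simp only [mul_assoc]
        _ = _ := by rw [h']; group
    simp only [σ, h, hKQ' q hq, hf, hf']
  obtain ⟨⟨x₀, y₀⟩, hp₀, -⟩ := Finset.exists_ne_zero_of_sum_ne_zero (h1.trans_ne one_ne_zero)
  have hx₀ : ∀ q ∈ Q, q * x₀ = x₀ * φ q := fun q hq =>
    (hfix _ (Finset.mem_filter.1 hp₀).2 q hq).1
  let W : G → Prop := fun w => (∀ q ∈ Q, Commute (φ q) w) ∧ K (x₀ * φ n * w * x₀⁻¹)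
  have hWQ : ∀ q ∈ Q, ∀ w, W w → φ q * w * (φ q)⁻¹ = w := fun q hq w hw => by
    rw [(hw.1 q hq).eq, mul_inv_cancel_right]
  have hWQ' : ∀ q ∈ Q, ∀ w, W (φ q * w * (φ q)⁻¹) ↔ W w := by
    refine fun q hq g => ⟨fun h => ?_, fun h => (hWQ q hq g h).symm ▸ h⟩
    have h' := hWQ q⁻¹ (Q.inv_mem hq) _ h
    rw [map_inv, show (φ q)⁻¹ * (φ q * g * (φ q)⁻¹) * (φ q)⁻¹⁻¹ = g by group] at h'
    exact h'.symm ▸ h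
  have h2 : ∑ p : G × G, (if W (p.2 * p.1) then U.coeff p.1 * V.coeff p.2 else 0) = 1 := by
    rw [hQ.sum_eq_sum_fixed σ σ_one σ_mul]
    · rw [← h1]
      refine Finset.sum_congr rfl fun p hp => ?_
      have hp' := hfix p (Finset.mem_filter.1 hp).2
      congr 1
      rw [eq_iff_iff]
      have hc : ∀ q ∈ Q, Commute (p.1 * x₀⁻¹) q := by
        intro q hq
        have h3 : φ q * x₀⁻¹ = x₀⁻¹ * q := by
          rw [eq_inv_mul_iff_mul_eq, ← mul_assoc, ← hx₀ q hq, mul_inv_cancel_right]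
        change p.1 * x₀⁻¹ * q = q * (p.1 * x₀⁻¹)
        rw [mul_assoc, ← h3, ← mul_assoc, ← mul_assoc, (hp' q hq).1]
      rw [← hKC' _ (fun q hq => (hc q hq).inv_left) (p.1 * φ n * p.2),
        show (p.1 * x₀⁻¹)⁻¹ * (p.1 * φ n * p.2) * (p.1 * x₀⁻¹)⁻¹⁻¹ =
          x₀ * φ n * (p.2 * p.1) * x₀⁻¹ by group]
      refine ⟨fun h => h.2, fun h => ⟨fun q hq => ?_, h⟩⟩
      change φ q * (p.2 * p.1) = p.2 * p.1 * φ q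
      rw [← mul_assoc, (hp' q hq).2, mul_assoc, (hp' q hq).1, mul_assoc]
    · rintro ⟨q, hq⟩ p
      have h : φ q * p.2 * q⁻¹ * (q * p.1 * (φ q)⁻¹) = φ q * (p.2 * p.1) * (φ q)⁻¹ := by group
      simp only [σ, h, hWQ' q hq, hf, hf']
  have h3 := sum_coeff_mul V U W
  rw [hVU, Finset.sum_filter, Finset.sum_filter,
    ← (Equiv.prodComm G G).sum_comp] at h3
  simp only [Equiv.prodComm_apply, Prod.fst_swap, Prod.snd_swap] at h3
  simp only [mul_comm (V.coeff _), h2, MonoidAlgebra.one_def, MonoidAlgebra.coeff_single,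
    Finsupp.single_apply] at h3
  obtain ⟨w, -, hw⟩ := Finset.exists_ne_zero_of_sum_ne_zero (h3.trans_ne one_ne_zero)
  obtain ⟨hW, hw'⟩ := ite_ne_right_iff.1 hw
  obtain ⟨rfl, -⟩ := ite_ne_right_iff.1 hw'
  obtain ⟨-, c, hc, h4⟩ := hW
  rw [mul_one] at h4
  refine ⟨c⁻¹ * x₀, fun q hq => ?_, ?_⟩
  · rw [mul_assoc, ← hx₀ q hq, ← mul_assoc, ← mul_assoc, (hc q hq).inv_left.eq]
  · rw [mul_inv_eq_iff_eq_mul] at h4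
    rw [mul_assoc, h4]
    group

end Parity

namespace MonoidAlgebra

variable {G : Type*} [Group G]

/-- The canonical anti-involution of an integral group ring, inverting the group elements. -/
noncomputable def invert : MonoidAlgebra ℤ G →ₐ[ℤ] (MonoidAlgebra ℤ G)ᵐᵒᵖ :=
  lift ℤ (MonoidAlgebra ℤ G)ᵐᵒᵖ G
    { toFun := fun g => .op (of ℤ G g⁻¹)
      map_one' := by simp [one_def]
      map_mul' := fun g h => by rw [← MulOpposite.op_mul, ← map_mul, mul_inv_rev] }

/-- The image of an element under the canonical anti-involution `MonoidAlgebra.invert`. -/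
noncomputable def bar (x : MonoidAlgebra ℤ G) : MonoidAlgebra ℤ G := (invert x).unop

theorem bar_mul (x y : MonoidAlgebra ℤ G) : bar (x * y) = bar y * bar x := by simp [bar]

theorem bar_one : bar (1 : MonoidAlgebra ℤ G) = 1 := by simp [bar]

theorem bar_pow (x : MonoidAlgebra ℤ G) (m : ℕ) : bar (x ^ m) = bar x ^ m := by simp [bar]

theorem bar_of (g : G) : bar (of ℤ G g) = of ℤ G g⁻¹ := by
  rw [bar, invert, lift_of]
  rfl

theorem coeff_bar (x : MonoidAlgebra ℤ G) (g : G) : (bar x).coeff g = x.coeff g⁻¹ := by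
  classical
  induction x using induction_linear with
  | zero => simp [bar]
  | add x y hx hy => simpa [bar] using congrArg₂ (· + ·) hx hy
  | single a r =>
    have h : single a r = r • of ℤ G a := by simp
    rw [h, bar, map_smul, MulOpposite.unop_smul, ← bar, bar_of]
    simp [Finsupp.single_apply, inv_eq_iff_eq_inv]

theorem bar_bar (x : MonoidAlgebra ℤ G) : bar (bar x) = x := by
  ext g
  rw [coeff_bar, coeff_bar, inv_inv]

theorem lift_one_bar (x : MonoidAlgebra ℤ G) :
    lift ℤ ℤ G (1 : G →* ℤ) (bar x) = lift ℤ ℤ G (1 : G →* ℤ) x := by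
  induction x using induction_linear with
  | zero => simp [bar]
  | add x y hx hy => simpa [bar] using congrArg₂ (· + ·) hx hy
  | single a r =>
    have h : single a r = r • of ℤ G a := by simp
    rw [h, bar, map_smul, MulOpposite.unop_smul, ← bar, bar_of]
    simp

theorem coeff_mul_bar_one [Fintype G] (x : MonoidAlgebra ℤ G) :
    (x * bar x).coeff 1 = ∑ g, x.coeff g ^ 2 := by
  rw [coeff_mul_apply_left, Finsupp.sum_fintype _ _ (by simp)]
  refine Finset.sum_congr rfl fun g _ => ?_
  rw [mul_one, coeff_bar, inv_inv, sq]

theorem exists_eq_single_of_mul_bar [Finite G] {x : MonoidAlgebra ℤ G} (hx : x * bar x = 1) :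
    ∃ h r, x = single h r := by
  classical
  have := Fintype.ofFinite G
  have h1 := coeff_mul_bar_one x
  rw [hx, coeff_one_one] at h1
  obtain ⟨h, -, hh⟩ := Finset.exists_ne_zero_of_sum_ne_zero (h1.symm.trans_ne one_ne_zero)
  refine ⟨h, x.coeff h, ?_⟩
  have h2 : ∀ g, g ≠ h → x.coeff g = 0 := by
    rw [← Finset.add_sum_erase _ _ (Finset.mem_univ h)] at h1
    have h3 : 0 < x.coeff h ^ 2 := lt_of_le_of_ne (sq_nonneg _) (Ne.symm hh)
    have h4 : ∑ g ∈ Finset.univ.erase h, x.coeff g ^ 2 = 0 :=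
      le_antisymm (by lia) (Finset.sum_nonneg fun _ _ => sq_nonneg _)
    rw [Finset.sum_eq_zero_iff_of_nonneg fun _ _ => sq_nonneg _] at h4
    intro g hg
    exact pow_eq_zero_iff two_ne_zero |>.1 (h4 g (by simpa using hg))
  ext g
  rw [coeff_single, Finsupp.single_apply]
  split_ifs with hg
  · rw [hg]
  · exact h2 g (Ne.symm hg)

/-- The unit `u` of `ℤ[G]` induces the automorphism `φ` of `G` by conjugation. -/
def Induces (u : (MonoidAlgebra ℤ G)ˣ) (φ : MulAut G) : Prop :=
  ∀ g, of ℤ G g * ↑u = ↑u * of ℤ G (φ g)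

theorem Induces.pow {u : (MonoidAlgebra ℤ G)ˣ} {φ : MulAut G} (h : Induces u φ) (m : ℕ) :
    Induces (u ^ m) (φ ^ m) := by
  induction m with
  | zero => intro g; simp
  | succ m ih =>
    intro g
    rw [pow_succ' φ, pow_succ, Units.val_mul, ← mul_assoc, ih g, mul_assoc, h, mul_assoc]
    rfl

theorem Induces.mul_of {u : (MonoidAlgebra ℤ G)ˣ} {φ : MulAut G} (h : Induces u φ) (x : G) :
    Induces (u * Units.map (of ℤ G) (toUnits x⁻¹)) (MulAut.conj x * φ) := by
  intro g
  rw [Units.val_mul, ← mul_assoc, h g, mul_assoc, mul_assoc]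
  simp only [Units.coe_map, val_toUnits_apply, ← map_mul, MulAut.mul_apply,
    MulAut.conj_apply]
  congr 2
  group

theorem Induces.exists_bar_eq [Finite G] {u : (MonoidAlgebra ℤ G)ˣ} {φ : MulAut G}
    (hu : Induces u φ) : ∃ h, bar (u : MonoidAlgebra ℤ G) = u * of ℤ G h := by
  set U : MonoidAlgebra ℤ G := ↑u with hU
  set V : MonoidAlgebra ℤ G := ↑u⁻¹ with hV
  have hUV : U * V = 1 := u.mul_inv
  have hVU : V * U = 1 := u.inv_mul
  have h1 : ∀ g, bar U * of ℤ G g = of ℤ G (φ g) * bar U := by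
    intro g
    have h := congrArg bar (hu g⁻¹)
    rwa [bar_mul, bar_mul, bar_of, bar_of, inv_inv, map_inv φ, inv_inv] at h
  have h2 : ∀ g, Commute (of ℤ G g) (U * bar U) := by
    intro g
    change of ℤ G g * (U * bar U) = U * bar U * of ℤ G g
    rw [← mul_assoc, hu g, mul_assoc, mul_assoc, h1]
  have h3 : ∀ x, Commute x (U * bar U) := by
    intro x
    induction x using induction_on with
    | of g => exact h2 g
    | add x y hx hy => exact hx.add_left hy
    | smul r x hx => exact hx.smul_left r
  have h4 : U * bar U = bar U * U := by
    have h := (h3 U).eq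
    rw [mul_assoc] at h
    exact u.isUnit.mul_left_cancel h
  have h5 : bar U * bar V = 1 := by rw [← bar_mul, hVU, bar_one]
  have h6 : (V * bar U) * bar (V * bar U) = 1 := by
    rw [bar_mul, bar_bar]
    calc V * bar U * (U * bar V) = V * (bar U * U) * bar V := by simp only [mul_assoc]
      _ = (V * U) * (bar U * bar V) := by rw [← h4]; simp only [mul_assoc]
      _ = 1 := by rw [hVU, h5, one_mul]
  obtain ⟨h, r, hr⟩ := exists_eq_single_of_mul_bar h6
  have h7 : r = 1 := by
    have h8 := congrArg (lift ℤ ℤ G (1 : G →* ℤ)) hr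
    rw [map_mul, lift_one_bar, ← map_mul, hVU, map_one] at h8
    simpa using h8.symm
  refine ⟨h, ?_⟩
  rw [of_apply, ← h7, ← hr, ← mul_assoc, hUV, one_mul]

theorem Induces.apply_eq_of_bar {u : (MonoidAlgebra ℤ G)ˣ} {φ : MulAut G}
    (hu : Induces u φ) {h : G} (hh : bar (u : MonoidAlgebra ℤ G) = u * of ℤ G h) (g : G) :
    φ (φ g) * h = h * g := by
  have h1 := congrArg bar (hu g⁻¹)
  rw [bar_mul, bar_mul, bar_of, bar_of, inv_inv, map_inv φ, inv_inv, hh, mul_assoc, ← map_mul,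
    ← mul_assoc, hu, mul_assoc, ← map_mul] at h1
  exact (of_injective (u.isUnit.mul_left_cancel h1)).symm

theorem Induces.apply_self_of_bar {u : (MonoidAlgebra ℤ G)ˣ} {φ : MulAut G}
    (hu : Induces u φ) {h : G} (hh : bar (u : MonoidAlgebra ℤ G) = u * of ℤ G h) : φ h = h := by
  have h1 := congrArg bar hh
  rw [bar_bar, bar_mul, bar_of, hh, ← mul_assoc, hu, mul_assoc, ← map_mul] at h1
  have h2 : of ℤ G (φ h⁻¹ * h) = 1 := u.isUnit.mul_left_cancel (by rw [← h1, mul_one])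
  have h3 : φ h⁻¹ * h = 1 := of_injective (h2.trans (map_one _).symm)
  rw [map_inv, inv_mul_eq_one] at h3
  exact h3

theorem Induces.bar_pow_eq {u : (MonoidAlgebra ℤ G)ˣ} {φ : MulAut G}
    (hu : Induces u φ) {h : G} (hh : bar (u : MonoidAlgebra ℤ G) = u * of ℤ G h) (m : ℕ) :
    bar ((u ^ m : (MonoidAlgebra ℤ G)ˣ) : MonoidAlgebra ℤ G) =
      (u ^ m : (MonoidAlgebra ℤ G)ˣ) * of ℤ G (h ^ m) := by
  have h1 : Commute (u : MonoidAlgebra ℤ G) (of ℤ G h) := by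
    have h2 := hu h
    rw [hu.apply_self_of_bar hh] at h2
    exact h2.symm
  rw [Units.val_pow_eq_pow_val, bar_pow, hh, h1.mul_pow, map_pow]

theorem Induces.exists_twisted_centralizer [Finite G] {u : (MonoidAlgebra ℤ G)ˣ} {φ : MulAut G}
    (hu : Induces u φ) {Q : Subgroup G} (hQ : IsPGroup 2 Q) {n : G}
    (hn : ∀ q ∈ Q, Commute n q) :
    ∃ x, (∀ q ∈ Q, q * x = x * φ q) ∧ n * x = x * φ n := by
  let ρ := mapRingHom G (Int.castRingHom (ZMod 2))
  have hρ : ∀ g, ρ (of ℤ G g) = of (ZMod 2) G g := fun g => by simp [ρ]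
  refine _root_.exists_twisted_centralizer (U := ρ u) (V := ρ ↑u⁻¹) ?_ ?_ (φ : G →* G) ?_ hQ hn
  · rw [← map_mul, u.mul_inv, map_one]
  · rw [← map_mul, u.inv_mul, map_one]
  · intro g
    rw [← hρ, ← hρ, ← map_mul, ← map_mul]
    exact congrArg ρ (hu g)

theorem sum_coeff_eq_one_mod_two [Fintype G] (u : (MonoidAlgebra ℤ G)ˣ) :
    ∑ g, (((u : MonoidAlgebra ℤ G).coeff g : ℤ) : ZMod 2) = 1 := by
  have h : IsUnit (((Int.castRingHom (ZMod 2)).comp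
      (lift ℤ ℤ G (1 : G →* ℤ)).toRingHom) (u : MonoidAlgebra ℤ G)) := u.isUnit.map _
  have h01 : ∀ c : ZMod 2, IsUnit c → c = 1 := by decide
  rw [← h01 _ h]
  simp [lift_apply, Finsupp.sum_fintype]

open Classical in
theorem Induces.exists_mul_self_eq [Finite G] {u : (MonoidAlgebra ℤ G)ˣ} {φ : MulAut G}
    (hu : Induces u φ) {h : G} (hh : bar (u : MonoidAlgebra ℤ G) = u * of ℤ G h)
    {Q : Subgroup G} (hQ : IsPGroup 2 Q) (hφ : ∀ q ∈ Q, φ q = q) (hhQ : h ∈ Q)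
    (hc : ∀ q ∈ Q, Commute h q) :
    ∃ g, (∀ q ∈ Q, Commute g q) ∧ g * g = h⁻¹ := by
  have := Fintype.ofFinite G
  set U : MonoidAlgebra ℤ G := ↑u with hU
  have h1 := sum_coeff_eq_one_mod_two u
  rw [← hU, hQ.sum_eq_sum_fixed (fun q g => q * g * (q : G)⁻¹) (by simp)
    (by simp [mul_assoc])] at h1
  swap
  · rintro ⟨q, hq⟩ x
    have h := congrArg (fun w => w.coeff (q * x)) (hu q)
    simp only [of_apply, coeff_single_mul_apply, coeff_mul_single_apply, one_mul, mul_one,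
      inv_mul_cancel_left, hφ q hq] at h
    exact congrArg _ h.symm
  have h2 : ∀ g, U.coeff (h⁻¹ * g⁻¹) = U.coeff g := by
    intro g
    have h3 := congrArg (fun w => w.coeff (g * h)) hh
    simpa [coeff_bar] using h3
  by_contra! hcon
  refine one_ne_zero (h1.symm.trans (Finset.sum_involution (fun g _ => h⁻¹ * g⁻¹) ?_ ?_ ?_ ?_))
  · intro g _
    rw [h2, ← two_mul]
    exact zero_mul _
  · intro g hg _ hgg
    simp only [Finset.mem_filter, Finset.mem_univ, true_and, Subtype.forall] at hg
    refine hcon g (fun q hq => (mul_inv_eq_iff_eq_mul.1 (hg q hq)).symm) ?_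
    nth_rw 1 [← hgg]
    rw [inv_mul_cancel_right]
  · intro g hg
    simp only [Finset.mem_filter, Finset.mem_univ, true_and, Subtype.forall] at hg ⊢
    intro q hq
    have hg' : Commute g q := (mul_inv_eq_iff_eq_mul.1 (hg q hq)).symm
    have h3 : Commute (h⁻¹ * g⁻¹) q := (hc q hq).inv_left.mul_left hg'.inv_left
    rw [← h3.eq, mul_inv_cancel_right]
  · intro g hg
    simp only [Finset.mem_filter, Finset.mem_univ, true_and, Subtype.forall] at hg
    have h3 := hg h⁻¹ (Q.inv_mem hhQ)
    simpa [mul_assoc] using h3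

end MonoidAlgebra

section Semidihedral

variable {H Γ : Type*} [Group H] [Group Γ]

theorem exists_zpow_of_closure_pair {a b : H} {k : ℕ} (hb : b * b = 1) (hab : b * a * b = a ^ k)
    (h : Subgroup.closure {a, b} = ⊤) (s : H) : ∃ i : ℤ, s = a ^ i ∨ s = a ^ i * b := by
  have hb' : b⁻¹ = b := inv_eq_of_mul_eq_one_left hb
  have hconj : ∀ i : ℤ, b * a ^ i = a ^ (k * i) * b := by
    intro i
    have h1 := conj_zpow (i := i) (a := b) (b := a)
    rw [hb', hab, ← zpow_natCast, ← zpow_mul] at h1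
    rw [h1, mul_assoc, hb, mul_one]
  let K : Subgroup H :=
    { carrier := {s | ∃ i : ℤ, s = a ^ i ∨ s = a ^ i * b}
      one_mem' := ⟨0, Or.inl (zpow_zero a).symm⟩
      mul_mem' := by
        rintro _ _ ⟨i, rfl | rfl⟩ ⟨j, rfl | rfl⟩
        · exact ⟨i + j, Or.inl (zpow_add a i j).symm⟩
        · exact ⟨i + j, Or.inr (by rw [zpow_add, mul_assoc])⟩
        · exact ⟨i + k * j, Or.inr (by rw [mul_assoc, hconj, zpow_add, mul_assoc])⟩
        · refine ⟨i + k * j, Or.inl ?_⟩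
          rw [mul_assoc, ← mul_assoc b, hconj, mul_assoc _ b b, hb, mul_one, zpow_add]
      inv_mem' := by
        rintro _ ⟨i, rfl | rfl⟩
        · exact ⟨-i, Or.inl (zpow_neg a i).symm⟩
        · exact ⟨k * -i, Or.inr (by rw [mul_inv_rev, hb', ← zpow_neg, hconj])⟩ }
  have hK : Subgroup.closure {a, b} ≤ K := by
    rw [Subgroup.closure_le]
    rintro _ (rfl | rfl)
    · exact ⟨1, Or.inl (zpow_one _).symm⟩
    · exact ⟨0, Or.inr (by simp)⟩
  exact hK (h ▸ Subgroup.mem_top s)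

theorem IsSemidihedral.exists_generators [Finite H] (h : IsSemidihedral H) :
    ∃ N, ∃ a b : H, ∀ f : H →* Γ, Function.Injective f →
      SemidihedralGenerators f.range (f a) (f b) N := by
  obtain ⟨n, hn, hcard, a, b, ha, hb, hab, hgen⟩ := h
  rw [sq] at hb
  rw [inv_eq_of_mul_eq_one_left hb] at hab
  have hcover := exists_zpow_of_closure_pair hb hab hgen
  have hn1 : 2 ^ (n - 1) = 2 * 2 ^ (n - 2) := by
    rw [← pow_succ', show n - 2 + 1 = n - 1 by lia]
  have hn2 : 2 ^ n = 2 * 2 ^ (n - 1) := by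
    rw [← pow_succ', show n - 1 + 1 = n by lia]
  have hdvd : orderOf a ∣ 2 ^ (n - 1) := orderOf_dvd_of_pow_eq_one ha
  have hle := Nat.le_of_dvd (by positivity) hdvd
  have hpos : 0 < 2 ^ (n - 1) := by positivity
  have hbm : b ∉ Subgroup.zpowers a := by
    intro hbm
    have h1 : ∀ s, s ∈ Subgroup.zpowers a := by
      intro s
      obtain ⟨i, rfl | rfl⟩ := hcover s
      · exact Subgroup.zpow_mem_zpowers a i
      · exact mul_mem (Subgroup.zpow_mem_zpowers a i) hbm
    rw [orderOf_eq_card_of_forall_mem_zpowers h1] at hle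
    lia
  have horder : orderOf a = 2 * 2 ^ (n - 2) := by
    rw [← hn1]
    refine le_antisymm hle ?_
    let F : Subgroup.zpowers a × Bool → H := fun p => if p.2 then p.1 * b else p.1
    have hF : Function.Surjective F := by
      intro s
      obtain ⟨i, rfl | rfl⟩ := hcover s
      · exact ⟨(⟨a ^ i, Subgroup.zpow_mem_zpowers a i⟩, false), rfl⟩
      · exact ⟨(⟨a ^ i, Subgroup.zpow_mem_zpowers a i⟩, true), rfl⟩
    have h1 := Nat.card_le_card_of_surjective F hF
    rw [Nat.card_prod, Nat.card_zpowers, hcard, hn2] at h1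
    simp only [Nat.card_eq_fintype_card, Fintype.card_bool] at h1
    lia
  refine ⟨2 ^ (n - 2), a, b, fun f hf => ?_⟩
  exact
    { pos := by positivity
      four_dvd := pow_dvd_pow 2 (show 2 ≤ n - 2 by lia)
      orderOf_eq := by rw [orderOf_injective f hf, horder]
      b_mul_b := by rw [← map_mul, hb, map_one]
      b_notMem := by
        rw [← MonoidHom.map_zpowers]
        rintro ⟨x, hx, hxb⟩
        exact hbm (hf hxb ▸ hx)
      conj := by rw [← map_mul, ← map_mul, hab, map_pow]
      a_mem := ⟨a, rfl⟩
      b_mem := ⟨b, rfl⟩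
      cover := by
        rintro _ ⟨s, rfl⟩
        obtain ⟨i, rfl | rfl⟩ := hcover s
        · exact ⟨i, Or.inl (map_zpow f a i)⟩
        · exact ⟨i, Or.inr (by rw [map_mul, map_zpow])⟩ }

end Semidihedral

section Normalizer

variable {G : Type*} [Group G] [Finite G]

theorem Sylow.mem_of_forall_commute {G : Type*} [Group G] {p : ℕ} [Fact p.Prime] (S : Sylow p G) {g : G}
    (hg : IsPGroup p (Subgroup.zpowers g)) (hc : ∀ s ∈ S, Commute g s) : g ∈ S := by
  have h1 : g ∈ Subgroup.zpowers g ⊓ Subgroup.normalizer (S : Set G) := by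
    refine ⟨Subgroup.mem_zpowers g, Subgroup.centralizer_le_normalizer _ ?_⟩
    exact Subgroup.mem_centralizer_iff.2 fun s hs => ((hc s hs).eq).symm
  rw [hg.inf_normalizer_sylow S] at h1
  exact h1.2

/-- An involutive automorphism that centralizes a semidihedral Sylow 2-subgroup and fixes the
conjugacy classes of all pairs consisting of a 2-subgroup and a centralizing element is inner. -/
theorem exists_eq_conj_of_involutive (S : Sylow 2 G) (hS : IsSemidihedral (S : Subgroup G))
    (φ : MulAut G) (hφ : φ * φ = 1) (hφS : ∀ s ∈ S, φ s = s)
    (hlift : ∀ Q : Subgroup G, IsPGroup 2 Q → ∀ n, (∀ q ∈ Q, Commute n q) →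
      ∃ x, (∀ q ∈ Q, q * x = x * φ q) ∧ n * x = x * φ n) :
    φ ∈ (MulAut.conj : G →* MulAut G).range := by
  by_cases hφ1 : φ = 1
  · rw [hφ1]
    exact one_mem _
  let Z : Subgroup (MulAut G) := Subgroup.zpowers φ
  let ι : G →* G ⋊[Z.subtype] Z := SemidirectProduct.inl
  have hι : Function.Injective ι := SemidirectProduct.inl_injective
  have hfin : Finite (G ⋊[Z.subtype] Z) := Finite.of_equiv _ SemidirectProduct.equivProd.symm
  let t : G ⋊[Z.subtype] Z := SemidirectProduct.inr ⟨φ, Subgroup.mem_zpowers φ⟩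
  have htt : t * t = 1 := by
    rw [← map_mul, ← map_one SemidirectProduct.inr]
    exact congrArg _ (Subtype.ext hφ)
  have htι : ∀ g, t * ι g = ι (φ g) * t := by
    intro g
    have h := SemidirectProduct.inl_aut (φ := Z.subtype) ⟨φ, Subgroup.mem_zpowers φ⟩ g
    change ι (φ g) = t * ι g * SemidirectProduct.inr _⁻¹ at h
    rw [map_inv] at h
    exact (eq_mul_inv_iff_mul_eq.1 h).symm
  have htn : t ∉ ι.range := by
    rw [SemidirectProduct.range_inl_eq_ker_rightHom, MonoidHom.mem_ker]
    exact fun h => hφ1 (congrArg Subtype.val h)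
  have hindex : ι.range.index = 2 := by
    rw [SemidirectProduct.range_inl_eq_ker_rightHom, Subgroup.index_ker,
      MonoidHom.range_eq_top.2 SemidirectProduct.rightHom_surjective, Subgroup.card_top,
      Nat.card_zpowers]
    exact orderOf_eq_prime (by rw [sq, hφ]) hφ1
  have htS : ∀ s ∈ (S : Subgroup G).map ι, Commute t s := by
    rintro _ ⟨s, hs, rfl⟩
    exact (htι s).trans (by rw [hφS s hs])
  have hR : IsPGroup 2 (Subgroup.zpowers t ⊔ (S : Subgroup G).map ι : Subgroup _) := by
    refine (isPGroup_two_zpowers_of_mul_self htt).to_sup_of_normal_right' (S.2.map ι) ?_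
    rw [Subgroup.zpowers_le]
    refine Subgroup.centralizer_le_normalizer _ ?_
    exact Subgroup.mem_centralizer_iff.2 fun s hs => ((htS s hs).eq).symm
  obtain ⟨T, hT⟩ := hR.exists_le_sylow
  have htT : t ∈ T := hT (Subgroup.mem_sup_left (Subgroup.mem_zpowers t))
  have hST : (S : Subgroup G).map ι ≤ T := le_sup_right.trans hT
  have hTS : (T : Subgroup (G ⋊[Z.subtype] Z)) ⊓ ι.range = (S : Subgroup G).map ι := by
    refine le_antisymm ?_ (le_inf hST (Subgroup.map_le_range ι _))
    rintro _ ⟨hx, g, rfl⟩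
    have h := S.3 (T.2.comap_of_injective ι hι) (Subgroup.map_le_iff_le_comap.1 hST)
    exact ⟨g, h ▸ hx, rfl⟩
  have htc : ∀ x ∈ T, Commute t x := by
    intro x hx
    by_cases hxι : x ∈ ι.range
    · exact htS x (hTS ▸ ⟨hx, hxι⟩)
    · have h1 : Commute t (x * t) := htS _ (hTS ▸ ⟨mul_mem hx htT,
        (Subgroup.mul_mem_iff_of_index_two hindex).2 (iff_of_false hxι htn)⟩)
      have h2 := h1.mul_right (Commute.refl t)
      rwa [mul_assoc, htt, mul_one] at h2
  obtain ⟨N, a, b, hab⟩ := hS.exists_generators (Γ := G ⋊[Z.subtype] Z)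
  have hD := hab (ι.comp (S : Subgroup G).subtype) (hι.comp Subtype.val_injective)
  rw [MonoidHom.range_comp, Subgroup.range_subtype, ← hTS] at hD
  have E : SemidihedralExtension ι.range T _ _ N :=
    { index := hindex
      gens := hD
      lift := by
        rintro Q hQι hQ _ ⟨n, rfl⟩ hn
        obtain ⟨x, hx, hxn⟩ := hlift (Q.comap ι) (hQ.comap_of_injective ι hι) n (by
          intro q hq
          exact hι (by simpa using (hn (ι q) hq).eq))
        have hkey : ∀ g, g * x = x * φ g → Commute (ι x * t) (ι g) := by
          intro g hg
          change ι x * t * ι g = ι g * (ι x * t)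
          rw [mul_assoc, htι, ← mul_assoc, ← map_mul, ← hg, map_mul, mul_assoc]
        refine ⟨ι x * t, ?_, ?_, hkey n hxn⟩
        · exact fun h => htn ((Subgroup.mul_mem_cancel_left _ (show ι x ∈ ι.range from ⟨x, rfl⟩)).1 h)
        · intro q hq
          obtain ⟨g, rfl⟩ := hQι hq
          exact hkey g (hx g hq) }
  rcases E.central_or_central_mul_z ⟨htT, htn, htt, htc⟩ with h | h
  · refine absurd (MulEquiv.ext fun g => hι ?_) hφ1
    have h1 := (h (ι g)).eq
    rw [htι] at h1
    exact (mul_right_cancel h1).symm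
  · obtain ⟨z, hz⟩ : ∃ z, ι z = (ι.comp (S : Subgroup G).subtype) a ^ N :=
      ⟨a ^ N, map_pow ι _ N⟩
    rw [← hz] at h
    refine ⟨(φ z)⁻¹, MulEquiv.ext fun g => ?_⟩
    have h1 := (h (ι g)).eq
    rw [mul_assoc, ← map_mul, htι, htι, ← mul_assoc, ← map_mul] at h1
    have h2 := hι (mul_right_cancel h1)
    rw [MulAut.conj_apply, inv_inv, mul_assoc, h2, map_mul, inv_mul_cancel_left]

open MonoidAlgebra in
theorem MonoidAlgebra.Induces.mem_range_conj (S : Sylow 2 G)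
    (hS : IsSemidihedral (S : Subgroup G)) {φ : MulAut G} {u : (MonoidAlgebra ℤ G)ˣ}
    (hu : Induces u φ) (hφS : ∀ s ∈ S, φ s = s) :
    φ ∈ (MulAut.conj : G →* MulAut G).range := by
  obtain ⟨h, hh⟩ := hu.exists_bar_eq
  have hφφ := hu.apply_eq_of_bar hh
  have hhS : ∀ s ∈ S, Commute h s := by
    intro s hs
    have h1 := hφφ s
    rw [hφS s hs, hφS s hs] at h1
    exact h1.symm
  obtain ⟨m, hm, hp⟩ := exists_odd_pow_isPGroup_two h
  have hmS : ∀ s ∈ S, Commute (h ^ m) s := fun s hs => (hhS s hs).pow_left m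
  have hmem : h ^ m ∈ S := S.mem_of_forall_commute hp hmS
  have hφmS : ∀ s ∈ S, (φ ^ m) s = s := by
    intro s hs
    clear hm hp hmS hmem
    induction m with
    | zero => rfl
    | succ m ih => rw [pow_succ, MulAut.mul_apply, hφS s hs, ih]
  have hum := hu.pow m
  have hbar := hu.bar_pow_eq hh m
  obtain ⟨N, a, b, hab⟩ := hS.exists_generators (Γ := G)
  have hD := hab (S : Subgroup G).subtype Subtype.val_injective
  rw [Subgroup.range_subtype] at hD
  have hcenter : ∀ g ∈ S, (∀ s ∈ S, Commute g s) → g * g = 1 := by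
    intro g hg hc
    rcases hD.eq_of_forall_commute hg hc with rfl | rfl
    · exact mul_one 1
    · exact hD.z_mul_z
  have hm1 : h ^ m = 1 := by
    obtain ⟨g, hgS, hgg⟩ := hum.exists_mul_self_eq hbar S.2 hφmS hmem hmS
    have h1 : g ^ 4 = 1 := by
      have h2 := hcenter _ hmem hmS
      rw [show g ^ 4 = (g * g) * (g * g) by simp only [pow_succ, pow_zero, one_mul, mul_assoc], hgg, ← mul_inv_rev, h2, inv_one]
    have h2 : IsPGroup 2 (Subgroup.zpowers g) := by
      obtain ⟨k, -, hk⟩ := (Nat.dvd_prime_pow Nat.prime_two).1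
        (orderOf_dvd_of_pow_eq_one (n := 2 ^ 2) h1)
      exact IsPGroup.of_card (n := k) (by rw [Nat.card_zpowers, hk])
    rw [hcenter g (S.mem_of_forall_commute h2 hgS) hgS] at hgg
    exact inv_eq_one.1 hgg.symm
  have hinv : φ ^ m * φ ^ m = 1 := by
    ext g
    have h1 := hum.apply_eq_of_bar hbar g
    rwa [hm1, mul_one, one_mul] at h1
  have hφm := exists_eq_conj_of_involutive S hS (φ ^ m) hinv hφmS
    fun Q hQ n hn => hum.exists_twisted_centralizer hQ hn
  have hsq : φ ^ 2 ∈ (MulAut.conj : G →* MulAut G).range :=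
    ⟨h, MulEquiv.ext fun g => mul_inv_eq_iff_eq_mul.2 (hφφ g).symm⟩
  obtain ⟨k, rfl⟩ := hm
  rw [pow_succ, pow_mul] at hφm
  exact (Subgroup.mul_mem_cancel_left _ (pow_mem hsq k)).1 hφm

end Normalizer

/-- If `G` is finite with semidihedral Sylow 2-subgroups and `φ` is an automorphism of `G`
induced by conjugation by a unit of the integral group ring `ℤ[G]`, then `φ` is inner;
i.e. `Aut_ℤ(G) = Inn(G)`, so `G` satisfies the normalizer problem. -/
theorem stmt_2 (G : Type*) [Group G] [Finite G]
    (hS : ∀ S : Sylow 2 G, IsSemidihedral (S : Subgroup G))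
    (φ : MulAut G) (u : (MonoidAlgebra ℤ G)ˣ)
    (hu : ∀ g : G, (MonoidAlgebra.of ℤ G (φ g) : MonoidAlgebra ℤ G) =
      ↑u⁻¹ * MonoidAlgebra.of ℤ G g * ↑u) :
    IsInnerAut φ := by
  have hu' : MonoidAlgebra.Induces u φ := by
    intro g
    rw [hu, ← mul_assoc, ← mul_assoc, u.mul_inv, one_mul]
  obtain ⟨S⟩ : Nonempty (Sylow 2 G) := inferInstance
  obtain ⟨x, hx, -⟩ := hu'.exists_twisted_centralizer S.2 (n := 1) fun q _ => Commute.one_left q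
  have h1 := (hu'.mul_of x).mem_range_conj S (hS S) fun s hs => by
    rw [MulAut.mul_apply, MulAut.conj_apply, ← hx s hs, mul_inv_cancel_right]
  obtain ⟨g, hg⟩ := (Subgroup.mul_mem_cancel_left _
    (show MulAut.conj x ∈ (MulAut.conj : G →* MulAut G).range from ⟨x, rfl⟩)).1 h1
  exact ⟨g, hg.symm⟩
end

section
/- Let G be a finite group, N a normal subgroup of G, and p a prime that does not divide the index [G : N]. If φ is a class-preserving automorphism of G whose order is a power of p, then φ(N) = N and the restriction of φ to N is a class-preserving automorphism of N; that is, for every n ∈ N, φ(n) is conjugate to n by an element of N. -/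
open scoped Pointwise

/-- A proper subgroup of a finite group does not meet every conjugacy class. -/
theorem Subgroup.eq_top_of_forall_exists_isConj {G : Type*} [Group G] [Finite G]
    (F : Subgroup G) (hF : ∀ g : G, ∃ y ∈ F, IsConj g y) : F = ⊤ := by
  classical
  have := Fintype.ofFinite G
  have burnside :=
    MulAction.sum_card_fixedBy_eq_card_orbits_mul_card_group G (G ⧸ F)
  have orbits : Fintype.card (Quotient (MulAction.orbitRel G (G ⧸ F))) = 1 :=
    Fintype.card_eq_one_iff_nonempty_unique.mpr
      ((MulAction.pretransitive_iff_unique_quotient_of_nonempty G (G ⧸ F)).mp inferInstance)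
  have pos (g : G) : 1 ≤ Fintype.card (MulAction.fixedBy (G ⧸ F) g) := by
    obtain ⟨y, hy, hgy⟩ := hF g
    obtain ⟨c, rfl⟩ := isConj_iff.mp hgy
    refine Fintype.card_pos_iff.mpr ⟨⟨(c⁻¹ : G), ?_⟩⟩
    change ((g * c⁻¹ : G) : G ⧸ F) = (c⁻¹ : G)
    rw [eq_comm, QuotientGroup.eq]
    simpa [mul_assoc] using hy
  by_contra hne
  have one : 1 < Fintype.card (MulAction.fixedBy (G ⧸ F) (1 : G)) := by
    have hcard : Fintype.card (MulAction.fixedBy (G ⧸ F) (1 : G)) = F.index := by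
      rw [Subgroup.index, ← Nat.card_eq_fintype_card, MulAction.fixedBy_one_eq_univ,
        Nat.card_univ]
    rw [hcard]
    have := F.index_ne_zero_of_finite
    have := mt Subgroup.index_eq_one.mp hne
    omega
  have lt := Finset.sum_lt_sum (fun g _ => pos g) ⟨(1 : G), Finset.mem_univ _, one⟩
  rw [burnside, orbits] at lt
  simp at lt

/-- A class-preserving automorphism maps every normal subgroup into itself. -/
theorem IsClassPres.apply_mem {G : Type*} [Group G] {φ : MulAut G} (hφ : IsClassPres φ)
    {N : Subgroup G} (hN : N.Normal) {n : G} (hn : n ∈ N) : φ n ∈ N := by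
  obtain ⟨c, hc⟩ := isConj_iff.mp (hφ n)
  exact hc ▸ hN.conj_mem n hn c

/-- A class-preserving automorphism of a finite group stabilizes every normal subgroup. -/
theorem IsClassPres.map_eq {G : Type*} [Group G] [Finite G] {φ : MulAut G}
    (hφ : IsClassPres φ) {N : Subgroup G} (hN : N.Normal) :
    N.map φ.toMonoidHom = N := by
  refine Subgroup.eq_of_le_of_card_ge ?_ ?_
  · rintro _ ⟨n, hn, rfl⟩
    exact hφ.apply_mem hN hn
  · exact (Nat.card_congr (N.equivMapOfInjective φ.toMonoidHom φ.injective).toEquiv).le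

/-- If `N` is normal of index prime to `p`, then a class-preserving automorphism of `p`-power
order fixes one of the `N`-classes contained in any given conjugacy class. -/
theorem IsClassPres.exists_isConj_conj_apply {G : Type*} [Group G] [Finite G]
    {N : Subgroup G} (hN : N.Normal) {p : ℕ} (hp : p.Prime) (hind : ¬ p ∣ N.index)
    {φ : MulAut G} (hord : ∃ k : ℕ, orderOf φ = p ^ k) (hφ : IsClassPres φ) (g : G) :
    ∃ y, IsConj g y ∧ ∃ m ∈ N, φ y = m * y * m⁻¹ := by
  have : Fact p.Prime := ⟨hp⟩
  let M : Subgroup (ConjAct G) := N.comap ConjAct.ofConjAct.toMonoidHom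
  have hM : M.Normal := hN.comap _
  have hMind : M.index = N.index :=
    Subgroup.index_comap_of_surjective N ConjAct.ofConjAct.surjective
  have smul_orbit (y : G) : φ • MulAction.orbit M y = MulAction.orbit M (φ y) := by
    apply Set.Subset.antisymm
    · rintro _ ⟨_, ⟨m, rfl⟩, rfl⟩
      refine ⟨⟨ConjAct.toConjAct (φ (ConjAct.ofConjAct m.1)), hφ.apply_mem hN m.2⟩, ?_⟩
      simp [Subgroup.smul_def, ConjAct.smul_def]
    · rintro _ ⟨m, rfl⟩
      have hm : ConjAct.ofConjAct m.1 ∈ N.map φ.toMonoidHom := by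
        rw [hφ.map_eq hN]; exact m.2
      obtain ⟨n, hn, hnm⟩ := hm
      refine ⟨_, ⟨⟨ConjAct.toConjAct n, hn⟩, rfl⟩, ?_⟩
      simp only [Subgroup.smul_def, ConjAct.smul_def, ← hnm]
      simp
  let X : Set (Set G) := {T | ∃ y, IsConj g y ∧ T = MulAction.orbit M y}
  have hX : X = MulAction.orbit (ConjAct G) (MulAction.orbit M g) := by
    ext T
    constructor
    · rintro ⟨y, hy, rfl⟩
      obtain ⟨c, rfl⟩ := isConj_iff.mp hy
      exact ⟨ConjAct.toConjAct c, MulAction.smul_orbit_eq_orbit_smul M _ _⟩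
    · rintro ⟨c, rfl⟩
      exact ⟨c • g, isConj_iff.mpr ⟨ConjAct.ofConjAct c, rfl⟩,
        MulAction.smul_orbit_eq_orbit_smul M _ _⟩
  have hcard : ¬ p ∣ Nat.card X := by
    rw [hX, Nat.card_coe_set_eq, ← MulAction.index_stabilizer]
    refine fun h => hind (hMind ▸ h.trans (Subgroup.index_dvd_of_le fun m hm => ?_))
    exact MulAction.smul_orbit (⟨m, hm⟩ : M) g
  let π : Equiv.Perm (Set G) := MulAction.toPermHom (MulAut G) (Set G) φ
  have mem_X (T : Set G) : π T ∈ X ↔ T ∈ X := by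
    constructor
    · rintro ⟨y, hy, hT⟩
      have hφy : φ (φ⁻¹ y) = y := φ.apply_symm_apply y
      refine ⟨φ⁻¹ y, hy.trans ?_, smul_left_cancel φ ?_⟩
      · simpa only [hφy] using (hφ (φ⁻¹ y)).symm
      · rw [smul_orbit, hφy]
        exact hT
    · rintro ⟨y, hy, rfl⟩
      exact ⟨φ y, hy.trans (hφ y), smul_orbit y⟩
  let σ : Equiv.Perm X := π.subtypePerm mem_X
  obtain ⟨k, hk⟩ := hord
  have := Fintype.ofFinite X
  have hσ : σ ^ p ^ k = 1 := by
    have hφk : φ ^ p ^ k = 1 := hk ▸ pow_orderOf_eq_one φ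
    have hπ : π ^ p ^ k = 1 := by rw [← map_pow, hφk, map_one]
    simp only [σ, Equiv.Perm.subtypePerm_pow, hπ]
    exact Equiv.Perm.subtypePerm_one _
  rw [Nat.card_eq_fintype_card] at hcard
  obtain ⟨⟨_, y, hy, rfl⟩, hT⟩ := Equiv.Perm.exists_fixed_point_of_prime hcard hσ
  have hfix : φ • MulAction.orbit M y = MulAction.orbit M y := congrArg Subtype.val hT
  obtain ⟨m, hm⟩ : φ y ∈ MulAction.orbit M y := by
    rw [← hfix, smul_orbit]
    exact MulAction.mem_orbit_self _
  exact ⟨y, hy, ConjAct.ofConjAct m.1, m.2, hm.symm⟩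

/-- A class-preserving automorphism of `p`-power order acts trivially on every quotient of order
prime to `p`. -/
theorem IsClassPres.inv_mul_apply_mem {G : Type*} [Group G] [Finite G]
    {N : Subgroup G} (hN : N.Normal) {p : ℕ} (hp : p.Prime) (hind : ¬ p ∣ N.index)
    {φ : MulAut G} (hord : ∃ k : ℕ, orderOf φ = p ^ k) (hφ : IsClassPres φ) (g : G) :
    g⁻¹ * φ g ∈ N := by
  let F : Subgroup G :=
    ((QuotientGroup.mk' N).comp φ.toMonoidHom).eqLocus (QuotientGroup.mk' N)
  have mem_F (y : G) : y ∈ F ↔ y⁻¹ * φ y ∈ N := by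
    rw [← QuotientGroup.eq, eq_comm]
    rfl
  have hF : F = ⊤ := F.eq_top_of_forall_exists_isConj fun y => by
    obtain ⟨z, hyz, m, hm, hz⟩ := hφ.exists_isConj_conj_apply hN hp hind hord y
    refine ⟨z, (mem_F z).mpr ?_, hyz⟩
    rw [hz, ← mul_assoc, ← mul_assoc]
    simpa using N.mul_mem (hN.conj_mem m hm z⁻¹) (N.inv_mem hm)
  exact (mem_F g).mp (hF ▸ Subgroup.mem_top g)

/-- A class-preserving automorphism of `p`-power order stabilizes a normal subgroup `N`
of index coprime to `p` and restricts to a class-preserving automorphism of `N`. -/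
theorem stmt_3 (G : Type*) [Group G] [Finite G] (N : Subgroup G) (hN : N.Normal)
    (p : ℕ) (hp : p.Prime) (hind : ¬ p ∣ N.index)
    (φ : MulAut G) (hord : ∃ k : ℕ, orderOf φ = p ^ k) (hcp : IsClassPres φ) :
    Subgroup.map φ.toMonoidHom N = N ∧
      ∀ n ∈ N, ∃ x ∈ N, φ n = x⁻¹ * n * x := by
  refine ⟨hcp.map_eq hN, fun n _ => ?_⟩
  obtain ⟨y, hy, m, hm, hmy⟩ := hcp.exists_isConj_conj_apply hN hp hind hord n
  obtain ⟨c, rfl⟩ := isConj_iff.mp hy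
  have hc := hcp.inv_mul_apply_mem hN hp hind hord c
  refine ⟨c⁻¹ * m⁻¹ * c * (c⁻¹ * φ c), N.mul_mem ?_ hc, ?_⟩
  · simpa using hN.conj_mem _ (N.inv_mem hm) c⁻¹
  · have hn : φ n = (φ c)⁻¹ * φ (c * n * c⁻¹) * φ c := by simp [mul_assoc]
    rw [hn, hmy]
    group
end

section
/- Let G be a finite group, N a normal subgroup of G, and p a prime that does not divide the index [G : N]. If φ is a Coleman automorphism of G whose order is a power of p and φ(N) = N, then the restriction of φ to N is a Coleman automorphism of N; that is, for every prime q and every Sylow q-subgroup Q of N there exists x ∈ N such that φ(u) = x⁻¹ * u * x for all u ∈ Q. -/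
/-- A Coleman automorphism induces a Coleman automorphism on every invariant quotient. -/
theorem IsColemanAut.quotient {G : Type*} [Group G] [Finite G] {N : Subgroup G} [N.Normal]
    {φ : MulAut G} (hφ : IsColemanAut φ) {ψ : MulAut (G ⧸ N)}
    (hψ : ∀ g : G, ψ (g : G ⧸ N) = (φ g : G ⧸ N)) : IsColemanAut ψ := by
  intro q hq R
  have : Fact q.Prime := ⟨hq⟩
  obtain ⟨P, rfl⟩ := Sylow.mapSurjective_surjective (QuotientGroup.mk'_surjective N) q R
  obtain ⟨x, hx⟩ := hφ q hq P
  refine ⟨(x : G ⧸ N), fun u hu => ?_⟩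
  obtain ⟨g, hg, rfl⟩ := hu
  rw [QuotientGroup.mk'_apply, hψ, hx g hg]
  rfl

/-- An exponent which is `1` modulo `p ^ k` and `0` modulo a number prime to `p`. -/
theorem exists_modEq_one_and_dvd {p n : ℕ} (hp : p.Prime) (hn : ¬ p ∣ n) (k : ℕ) :
    ∃ m : ℕ, m ≡ 1 [MOD p ^ k] ∧ n ∣ m := by
  have hc : (p ^ k).Coprime n := ((hp.coprime_iff_not_dvd).2 hn).pow_left k
  obtain ⟨m, h₁, h₂⟩ := Nat.chineseRemainder hc 1 0
  exact ⟨m, h₁, (Nat.modEq_zero_iff_dvd).1 h₂⟩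

theorem pow_eq_self_of_modEq_one {G : Type*} [Group G] {g : G} {n m : ℕ}
    (hg : orderOf g = n) (hm : m ≡ 1 [MOD n]) : g ^ m = g := by
  conv_rhs => rw [← pow_one g]
  exact pow_eq_pow_iff_modEq.2 (hg ▸ hm)

/-- A Coleman automorphism of `p`-power order of a finite group of order prime to `p`
is trivial. -/
theorem IsColemanAut.eq_one_of_not_dvd_card {H : Type*} [Group H] [Finite H] {p k : ℕ}
    (hp : p.Prime) (hcard : ¬ p ∣ Nat.card H) {ψ : MulAut H} (hψ : IsColemanAut ψ)
    (hk : orderOf ψ ∣ p ^ k) : ψ = 1 := by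
  have : Fact p.Prime := ⟨hp⟩
  obtain ⟨m, hm₁, hm₂⟩ := exists_modEq_one_and_dvd hp hcard k
  have hpow : ψ ^ m = ψ := pow_eq_self_of_modEq_one rfl (hm₁.of_dvd hk)
  let F : Subgroup H := ψ.toMonoidHom.eqLocus (MonoidHom.id H)
  suffices hF : F.index = 1 by
    ext h
    have : h ∈ F := by rw [Subgroup.index_eq_one.1 hF]; trivial
    exact this
  by_contra hF
  obtain ⟨q, hq, hqF⟩ := Nat.exists_prime_and_dvd hF
  have : Fact q.Prime := ⟨hq⟩
  have hgrp : IsPGroup p (Subgroup.zpowers ψ) := by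
    obtain ⟨j, -, hj⟩ := (Nat.dvd_prime_pow hp).1 hk
    exact IsPGroup.of_card (n := j) (by rw [Nat.card_zpowers, hj])
  have hSyl : ¬ p ∣ Nat.card (Sylow q H) := fun h =>
    hcard ((h.trans (Sylow.card_dvd_index default)).trans (Subgroup.index_dvd_card _))
  obtain ⟨R, hR⟩ := hgrp.nonempty_fixed_point_of_prime_not_dvd_card (Sylow q H) hSyl
  have hRψ : ψ • R = R := hR ⟨ψ, Subgroup.mem_zpowers ψ⟩
  have hmem : ∀ u ∈ (R : Subgroup H), ψ u ∈ (R : Subgroup H) := by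
    intro u hu
    have h := Subgroup.smul_mem_pointwise_smul u ψ (R : Subgroup H) hu
    rw [← Sylow.pointwise_smul_def, hRψ] at h
    exact h
  obtain ⟨x, hx⟩ := hψ q hq R
  have key : ∀ n : ℕ, ∀ u ∈ (R : Subgroup H), (ψ ^ n) u = (x ^ n)⁻¹ * u * x ^ n := by
    intro n
    induction n with
    | zero => simp
    | succ n ih =>
      intro u hu
      rw [pow_succ, MulAut.mul_apply, ih _ (hmem u hu), hx u hu]
      group
  have hle : (R : Subgroup H) ≤ F := by
    intro u hu
    have h := key m u hu
    have hxm : x ^ m = 1 := orderOf_dvd_iff_pow_eq_one.1 ((orderOf_dvd_natCard x).trans hm₂)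
    rw [hpow, hxm] at h
    rw [inv_one, one_mul, mul_one] at h
    exact h
  exact R.not_dvd_index (hqF.trans (Subgroup.index_dvd_of_le hle))

/-- If `φ` acts trivially modulo `N`, powers of `conj x * φ` are powers of `φ` up to conjugation
by an element congruent to a power of `x` modulo `N`. -/
theorem exists_conj_mul_pow_eq {G : Type*} [Group G] {N : Subgroup G} [N.Normal] {φ : MulAut G}
    (hφ : ∀ g : G, (φ g : G ⧸ N) = g) (x : G) (m : ℕ) :
    ∃ y : G, (y : G ⧸ N) = (x ^ m : G) ∧
      (MulAut.conj x * φ) ^ m = MulAut.conj y * φ ^ m := by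
  induction m with
  | zero => exact ⟨1, by simp⟩
  | succ m ih =>
    obtain ⟨y, hy, h⟩ := ih
    refine ⟨x * φ y, ?_, ?_⟩
    · rw [QuotientGroup.mk_mul, hφ, hy, ← QuotientGroup.mk_mul, ← pow_succ']
    · rw [pow_succ', h]
      ext g
      simp [pow_succ', mul_assoc]

/-- A Coleman automorphism of `p`-power order stabilizing a normal subgroup `N` of index
coprime to `p` restricts to a Coleman automorphism of `N`. -/
theorem stmt_4 (G : Type*) [Group G] [Finite G] (N : Subgroup G) (hN : N.Normal)
    (p : ℕ) (hp : p.Prime) (hind : ¬ p ∣ N.index)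
    (φ : MulAut G) (hord : ∃ k : ℕ, orderOf φ = p ^ k) (hcol : IsColemanAut φ)
    (hstab : Subgroup.map φ.toMonoidHom N = N) :
    ∀ q : ℕ, q.Prime → ∀ Q : Sylow q N, ∃ x ∈ N,
      ∀ u : N, u ∈ (Q : Subgroup N) → φ (u : G) = x⁻¹ * (u : G) * x := by
  intro q hq Q
  obtain ⟨k, hk⟩ := hord
  let ψ : MulAut (G ⧸ N) := QuotientGroup.congr N N φ hstab
  have hψ : ∀ g : G, ψ (g : G ⧸ N) = (φ g : G ⧸ N) := fun g => rfl
  have hψpow : ∀ (n : ℕ) (g : G), (ψ ^ n) (g : G ⧸ N) = ((φ ^ n) g : G) := by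
    intro n
    induction n with
    | zero => intro g; rfl
    | succ n ih => intro g; rw [pow_succ, pow_succ, MulAut.mul_apply, hψ, ih]; rfl
  have hψord : orderOf ψ ∣ p ^ k := by
    refine orderOf_dvd_of_pow_eq_one (MulEquiv.ext fun z => ?_)
    obtain ⟨g, rfl⟩ := QuotientGroup.mk_surjective z
    rw [hψpow, ← hk, pow_orderOf_eq_one]
    rfl
  have hψ_one : ψ = 1 := (hcol.quotient hψ).eq_one_of_not_dvd_card hp hind hψord
  have htriv : ∀ g : G, (φ g : G ⧸ N) = g := fun g => by rw [← hψ, hψ_one]; rfl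
  have : Fact q.Prime := ⟨hq⟩
  obtain ⟨P, hP⟩ := (Q.isPGroup'.map N.subtype).exists_le_sylow
  obtain ⟨x, hx⟩ := hcol q hq P
  obtain ⟨m, hm₁, hm₂⟩ := exists_modEq_one_and_dvd hp hind k
  obtain ⟨y, hy, hym⟩ := exists_conj_mul_pow_eq htriv x m
  have hxm : x ^ m ∈ N := by
    obtain ⟨d, rfl⟩ := hm₂
    rw [pow_mul]
    exact N.pow_mem (N.pow_index_mem x) d
  refine ⟨y, ?_, fun u hu => ?_⟩
  · rwa [← QuotientGroup.eq_one_iff, hy, QuotientGroup.eq_one_iff]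
  · have hfix : (MulAut.conj x * φ) (u : G) = u := by
      rw [MulAut.mul_apply, MulAut.conj_apply, hx u (hP ⟨u, hu, rfl⟩)]
      group
    have hfixm : ((MulAut.conj x * φ) ^ m) (u : G) = u := by
      rw [← MulAut.smul_def]
      exact MulAction.mem_stabilizer_iff.1
        (Subgroup.pow_mem _ (MulAction.mem_stabilizer_iff.2 hfix) m)
    rw [hym, pow_eq_self_of_modEq_one hk hm₁, MulAut.mul_apply, MulAut.conj_apply] at hfixm
    rw [mul_inv_eq_iff_eq_mul] at hfixm
    rw [mul_assoc, ← hfixm, inv_mul_cancel_left]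
end

section
/- Let p be a prime and G a finite group. Suppose φ is a non-inner automorphism of G whose order is a power of p, such that φ(g) is conjugate to g for every element g ∈ G of p-power order, and such that for every nontrivial normal subgroup N of G with φ(N) = N the automorphism induced by φ on G/N is inner. If the Sylow p-subgroups of G are abelian, then every normal p-subgroup of G is trivial (i.e. O_p(G) = 1). -/
/-- Inner automorphisms form a normal subgroup of the automorphism group. -/
theorem MulAut.normal_range_conj (G : Type*) [Group G] :
    (MulAut.conj : G →* MulAut G).range.Normal := by
  refine ⟨?_⟩
  rintro _ ⟨g, rfl⟩ f
  refine ⟨f g, ?_⟩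
  ext x
  simp [MulAut.mul_apply]

/-- If the order of `φ` is prime to `m` and the `m`-th power of some automorphism in the outer class
of `φ` is inner, then `φ` is inner. -/
theorem isInnerAut_of_conj_mul_pow {G : Type*} [Group G] {φ : MulAut G} {x : G} {m n : ℕ}
    (hmn : m.Coprime n) (hφ : φ ^ n = 1) (h : IsInnerAut ((MulAut.conj x * φ) ^ m)) :
    IsInnerAut φ := by
  have := MulAut.normal_range_conj G
  let q := QuotientGroup.mk' (MulAut.conj : G →* MulAut G).range
  have hx : q (MulAut.conj x) = 1 := (QuotientGroup.eq_one_iff _).2 ⟨x, rfl⟩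
  have hm : q φ ^ m = 1 := by
    obtain ⟨g, hg⟩ := h
    have : q ((MulAut.conj x * φ) ^ m) = 1 := (QuotientGroup.eq_one_iff _).2 ⟨g, hg.symm⟩
    simpa [hx] using this
  have hn : q φ ^ n = 1 := by rw [← map_pow, hφ, map_one]
  have h1 : q φ = 1 := by
    rw [← orderOf_eq_one_iff]
    exact Nat.eq_one_of_dvd_coprimes hmn (orderOf_dvd_of_pow_eq_one hm)
      (orderOf_dvd_of_pow_eq_one hn)
  obtain ⟨g, hg⟩ := (QuotientGroup.eq_one_iff _).1 h1
  exact ⟨g, hg.symm⟩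

/-- An automorphism of `p`-power order that moves elements only within their cosets of an abelian
Sylow `p`-subgroup and preserves the conjugacy classes of `p`-elements fixes that subgroup
pointwise. -/
theorem apply_eq_self_of_mem_sylow {G : Type*} [Group G] [Finite G] {p : ℕ} [Fact p.Prime]
    (P : Sylow p G) [IsMulCommutative P] {ψ : MulAut G} {a : ℕ} (hψ : ψ ^ p ^ a = 1)
    (hP : ∀ g, ψ g * g⁻¹ ∈ P) (hconj : ∀ g ∈ P, IsConj g (ψ g)) {u : G} (hu : u ∈ P) :
    ψ u = u := by
  have hcomm : ∀ x ∈ P, ∀ y ∈ P, Commute x y := fun x hx y hy =>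
    congrArg Subtype.val (mul_comm' (⟨x, hx⟩ : P) ⟨y, hy⟩)
  have hψu : ψ u ∈ P := by simpa using mul_mem (hP u) hu
  obtain ⟨c, hc⟩ := isConj_iff.1 (hconj u hu)
  obtain ⟨n, hn, hcn⟩ := P.conj_eq_normalizer_conj_of_mem u c⁻¹ hu (by simpa [hc] using hψu)
  obtain ⟨n, rfl⟩ : ∃ k, n = k⁻¹ := ⟨n⁻¹, by simp⟩
  have hn' : n ∈ Subgroup.normalizer (P : Set G) := by simpa using inv_mem hn
  replace hcn : ψ u = n * u * n⁻¹ := by simpa [hc] using hcn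
  have hstep : ∀ v ∈ P, ψ (n * v * n⁻¹) = n * ψ v * n⁻¹ := by
    intro v hv
    have hψv : ψ v ∈ P := by simpa using mul_mem (hP v) hv
    have hv' : n * ψ v * n⁻¹ ∈ P := (Subgroup.mem_normalizer_iff.1 hn' _).1 hψv
    have := (hcomm _ (hP n) _ hv').eq
    calc ψ (n * v * n⁻¹) = (ψ n * n⁻¹) * (n * ψ v * n⁻¹) * (ψ n * n⁻¹)⁻¹ := by
          simp only [map_mul, map_inv]; group
      _ = n * ψ v * n⁻¹ := by rw [this]; group
  have hiter : ∀ i : ℕ, n ^ i * u * (n ^ i)⁻¹ ∈ P ∧ (ψ ^ i) u = n ^ i * u * (n ^ i)⁻¹ ∧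
      ψ (n ^ i * u * (n ^ i)⁻¹) = n * (n ^ i * u * (n ^ i)⁻¹) * n⁻¹ := by
    intro i
    induction i with
    | zero => simp [hu, hcn]
    | succ i ih =>
      obtain ⟨h1, h2, h3⟩ := ih
      have e : n ^ (i + 1) * u * (n ^ (i + 1))⁻¹ = n * (n ^ i * u * (n ^ i)⁻¹) * n⁻¹ := by
        rw [pow_succ']; group
      rw [e]
      refine ⟨(Subgroup.mem_normalizer_iff.1 hn' _).1 h1, ?_, ?_⟩
      · rw [pow_succ', MulAut.mul_apply, h2, h3]
      · rw [hstep _ h1, h3]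
  have hpa : Commute (n ^ p ^ a) u := by
    have h := (hiter (p ^ a)).2.1
    rw [hψ, MulAut.one_apply] at h
    exact (eq_mul_inv_iff_mul_eq.1 h).symm
  obtain ⟨b, m, hm, hbm⟩ := Nat.exists_eq_pow_mul_and_not_dvd (orderOf_pos n).ne' p
    (Fact.out : p.Prime).ne_one
  have hnm : n ^ m ∈ P := by
    have hpg : IsPGroup p (Subgroup.zpowers (n ^ m)) := by
      refine IsPGroup.of_card (n := b) ?_
      rw [Nat.card_zpowers, orderOf_pow, hbm, Nat.gcd_eq_right (dvd_mul_left _ _),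
        Nat.mul_div_cancel _ (Nat.pos_of_ne_zero (by rintro rfl; simp at hm))]
    have hmem : n ^ m ∈ Subgroup.zpowers (n ^ m) ⊓ Subgroup.normalizer (P : Set G) :=
      ⟨Subgroup.mem_zpowers _, pow_mem hn' m⟩
    rw [hpg.inf_normalizer_sylow P] at hmem
    exact hmem.2
  have hcop : (p ^ a).Coprime m :=
    Nat.Coprime.pow_left a (((Fact.out : p.Prime).coprime_iff_not_dvd).2 hm)
  have hnu : n ∈ Subgroup.centralizer {u} := by
    have h1 : n ^ p ^ a ∈ Subgroup.centralizer {u} :=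
      Subgroup.mem_centralizer_singleton_iff.2 hpa
    have h2 : n ^ m ∈ Subgroup.centralizer {u} :=
      Subgroup.mem_centralizer_singleton_iff.2 (hcomm _ hnm _ hu)
    have hbez := Nat.gcd_eq_gcd_ab (p ^ a) m
    rw [hcop.gcd_eq_one] at hbez
    have : n = (n ^ p ^ a) ^ (Nat.gcdA (p ^ a) m) * (n ^ m) ^ (Nat.gcdB (p ^ a) m) := by
      rw [← zpow_natCast, ← zpow_natCast n m, ← zpow_mul, ← zpow_mul, ← zpow_add, ← hbez]
      simp
    rw [this]
    exact mul_mem (zpow_mem h1 _) (zpow_mem h2 _)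
  rw [hcn, Subgroup.mem_centralizer_singleton_iff.1 hnu, mul_inv_cancel_right]

/-- An automorphism inducing the identity on `G ⧸ Q`, with `Q` abelian and normal, is inner as soon
as it fixes pointwise a subgroup of index prime to `|Q|`. -/
theorem isInnerAut_of_fixes_subgroup {G : Type*} [Group G] [Finite G] (Q H : Subgroup G)
    [Q.Normal] [IsMulCommutative Q] (hcop : (Nat.card Q).Coprime H.index)
    {ψ : MulAut G} (hfix : ∀ u ∈ H, ψ u = u) (hQ : ∀ g, ψ g * g⁻¹ ∈ Q) :
    IsInnerAut ψ := by
  let _ : CommGroup Q := { mul_comm := mul_comm' }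
  have := Fintype.ofFinite (G ⧸ H)
  let δ : G → Q := fun g => ⟨ψ g * g⁻¹, hQ g⟩
  have hδ : ∀ g h, δ (g * h) = δ g * MulAut.conjNormal g (δ h) := by
    intro g h
    ext
    have hc : (δ g : G) * (g * δ h * g⁻¹) = (g * δ h * g⁻¹) * δ g :=
      congrArg Subtype.val (mul_comm (δ g) (MulAut.conjNormal g (δ h)))
    simp only [δ] at hc
    simp only [δ, Subgroup.coe_mul, MulAut.conjNormal_apply, map_mul]
    rw [show ψ g * ψ h * (g * h)⁻¹ = ψ g * (ψ h * h⁻¹) * g⁻¹ by group]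
    group
  let d : G ⧸ H → Q := Quotient.lift δ <| by
    intro g h hgh
    have hu : g⁻¹ * h ∈ H := QuotientGroup.leftRel_apply.1 hgh
    have := hfix _ hu
    rw [map_mul, map_inv, inv_mul_eq_iff_eq_mul] at this
    ext
    simp only [δ, this]
    group
  have hd : ∀ g c, d (g • c) = δ g * MulAut.conjNormal g (d c) := by
    intro g c
    induction c using QuotientGroup.induction_on with
    | H h => exact hδ g h
  have hprod : ∀ g, ∏ c, d c = δ g ^ H.index * MulAut.conjNormal g (∏ c, d c) := by
    intro g
    conv_lhs => rw [← Equiv.prod_comp (MulAction.toPerm g) d]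
    simp only [MulAction.toPerm_apply, hd, Finset.prod_mul_distrib, Finset.prod_const, map_prod]
    rw [Finset.card_univ, ← Nat.card_eq_fintype_card]
    rfl
  obtain ⟨c, hc⟩ := (powCoprime hcop).surjective (∏ c, d c)
  replace hc : c ^ H.index = ∏ c, d c := hc
  refine ⟨c, MulEquiv.ext fun g => ?_⟩
  have h := hprod g
  rw [← hc, map_pow, ← mul_pow] at h
  have h' := congrArg Subtype.val ((powCoprime hcop).injective h)
  simp only [δ, Subgroup.coe_mul, MulAut.conjNormal_apply] at h'
  rw [MulAut.conj_apply]
  nth_rewrite 1 [h']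
  group

/-- The intersection of the Sylow `p`-subgroups is characteristic. -/
theorem characteristic_iInf_sylow (p : ℕ) (G : Type*) [Group G] :
    (⨅ P : Sylow p G, (P : Subgroup G)).Characteristic := by
  rw [Subgroup.characteristic_iff_le_comap]
  intro f x hx
  simp only [Subgroup.mem_comap, Subgroup.mem_iInf] at hx ⊢
  intro P
  have := hx ((f⁻¹ : MulAut G) • P)
  rw [Sylow.pointwise_smul_def, Subgroup.mem_pointwise_smul_iff_inv_smul_mem] at this
  simpa using this

/-- A normal `p`-subgroup is contained in every Sylow `p`-subgroup. -/
theorem IsPGroup.le_iInf_sylow {p : ℕ} {G : Type*} [Group G] [Finite G] [Fact p.Prime]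
    {N : Subgroup G} [hN : N.Normal] (h : IsPGroup p N) :
    N ≤ ⨅ P : Sylow p G, (P : Subgroup G) := by
  obtain ⟨P, hP⟩ := h.exists_le_sylow
  refine le_iInf fun R => ?_
  obtain ⟨g, rfl⟩ := MulAction.exists_smul_eq G P R
  intro x hx
  have := hP (hN.conj_mem x hx g⁻¹)
  rw [Sylow.smul_def, Sylow.pointwise_smul_def, Subgroup.mem_pointwise_smul_iff_inv_smul_mem]
  simpa using this

/-- Hertweck's lemma (ii): under the hypotheses of Lemma 5, if the Sylow `p`-subgroups
of `G` are abelian, then `O_p(G) = 1`. -/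
theorem stmt_8 (G : Type*) [Group G] [Finite G] (p : ℕ) (hp : p.Prime)
    (φ : MulAut G) (hni : ¬ IsInnerAut φ) (hord : ∃ k : ℕ, orderOf φ = p ^ k)
    (hpcl : ∀ g : G, (∃ k : ℕ, g ^ (p ^ k) = 1) → IsConj g (φ g))
    (hquot : ∀ N : Subgroup G, N.Normal → N ≠ ⊥ → Subgroup.map φ.toMonoidHom N = N →
      ∃ x : G, ∀ g : G, φ g * (x⁻¹ * g * x)⁻¹ ∈ N)
    (hab : ∀ P : Sylow p G, ∀ x ∈ (P : Subgroup G), ∀ y ∈ (P : Subgroup G), x * y = y * x) :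
    ∀ N : Subgroup G, N.Normal → IsPGroup p N → N = ⊥ := by
  intro N hN hNp
  by_contra hne
  have : Fact p.Prime := ⟨hp⟩
  let Q : Subgroup G := ⨅ P : Sylow p G, (P : Subgroup G)
  have hchar : Q.Characteristic := characteristic_iInf_sylow p G
  have hQ1 : Q ≠ ⊥ := fun h => hne (le_bot_iff.1 (h ▸ hNp.le_iInf_sylow))
  obtain ⟨P⟩ := (inferInstance : Nonempty (Sylow p G))
  have hQP : Q ≤ P := iInf_le _ P
  have : IsMulCommutative P := ⟨⟨fun x y => Subtype.ext (hab P x x.2 y y.2)⟩⟩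
  have : IsMulCommutative Q :=
    ⟨⟨fun x y => Subtype.ext (hab P x (hQP x.2) y (hQP y.2))⟩⟩
  obtain ⟨x, hx⟩ := hquot Q inferInstance hQ1 (Subgroup.characteristic_iff_map_eq.1 hchar φ)
  obtain ⟨k, hk⟩ := hord
  let ψ : MulAut G := MulAut.conj x * φ
  obtain ⟨a, m, hm, ham⟩ := Nat.exists_eq_pow_mul_and_not_dvd (orderOf_pos ψ).ne' p hp.ne_one
  have hψQ : ∀ g, ψ g * g⁻¹ ∈ Q := by
    intro g
    have := (inferInstance : Q.Normal).conj_mem _ (hx g) x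
    convert this using 1
    simp only [ψ, MulAut.mul_apply, MulAut.conj_apply]
    group
  have hψc : ∀ g, (∃ k : ℕ, g ^ p ^ k = 1) → IsConj g (ψ g) := fun g hg =>
    (hpcl g hg).trans (isConj_iff.2 ⟨x, rfl⟩)
  have hpowQ : ∀ i : ℕ, ∀ g, (ψ ^ i) g * g⁻¹ ∈ Q := by
    intro i
    induction i with
    | zero => simp
    | succ i ih =>
      intro g
      have := mul_mem (hψQ ((ψ ^ i) g)) (ih g)
      simpa [pow_succ', MulAut.mul_apply] using this
  have hpowc : ∀ i : ℕ, ∀ g, (∃ k : ℕ, g ^ p ^ k = 1) → IsConj g ((ψ ^ i) g) := by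
    intro i
    induction i with
    | zero => exact fun g _ => IsConj.refl g
    | succ i ih =>
      rintro g ⟨k, hg⟩
      rw [pow_succ', MulAut.mul_apply]
      exact (ih g ⟨k, hg⟩).trans (hψc _ ⟨k, by rw [← map_pow, hg, map_one]⟩)
  have hfix : ∀ u ∈ (P : Subgroup G), (ψ ^ m) u = u := fun u hu =>
    apply_eq_self_of_mem_sylow P (a := a)
      (by rw [← pow_mul, mul_comm, ← ham, pow_orderOf_eq_one])
      (fun g => hQP (hpowQ m g))
      (fun g hg => hpowc m g <| by
        obtain ⟨j, hj⟩ := P.isPGroup' ⟨g, hg⟩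
        exact ⟨j, congrArg Subtype.val hj⟩) hu
  have hcop : (Nat.card Q).Coprime (P : Subgroup G).index := by
    obtain ⟨j, hj⟩ := IsPGroup.iff_card.1 (P.isPGroup'.to_le hQP)
    rw [hj]
    exact Nat.Coprime.pow_left j ((hp.coprime_iff_not_dvd).2 P.not_dvd_index)
  refine hni (isInnerAut_of_conj_mul_pow (m := m) (n := p ^ k) (x := x) ?_
    (hk ▸ pow_orderOf_eq_one φ) (isInnerAut_of_fixes_subgroup Q P hcop hfix (hpowQ m)))
  exact (Nat.Coprime.pow_left k ((hp.coprime_iff_not_dvd).2 hm)).symm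
end

section
/- Let p be a prime, G a finite group, and φ an automorphism of G whose order is a power of p. Assume there is a normal subgroup N of G such that φ(n) = n for all n ∈ N and φ(g) * g⁻¹ ∈ N for all g ∈ G. Let P be the p-primary component of the center Z(N), i.e. the subgroup of all elements of Z(N) whose order is a power of p. Then P is a normal subgroup of G and φ(g) * g⁻¹ ∈ P for all g ∈ G; that is, φ induces the identity on G/P. -/
/-- If `φ` fixes a normal subgroup `N` pointwise and induces the identity on `G/N`, then each
`φ g * g⁻¹` commutes with every element of `N`. -/
theorem MulAut.map_mul_inv_comm_of_fixes {G : Type*} [Group G] {φ : MulAut G}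
    {N : Subgroup G} (hN : N.Normal) (hfix : ∀ n ∈ N, φ n = n) (g : G) {y : G} (hy : y ∈ N) :
    φ g * g⁻¹ * y = y * (φ g * g⁻¹) := by
  have h := hfix _ (hN.conj_mem y hy g⁻¹)
  simp only [map_mul, map_inv, inv_inv, hfix y hy] at h
  calc φ g * g⁻¹ * y = φ g * (g⁻¹ * y * g) * g⁻¹ := by group
    _ = φ g * ((φ g)⁻¹ * y * φ g) * g⁻¹ := by rw [h]
    _ = y * (φ g * g⁻¹) := by group

/-- If `φ` fixes `φ g * g⁻¹`, then its powers translate `g` by the powers of `φ g * g⁻¹`. -/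
theorem MulAut.pow_apply_eq_of_fixes {G : Type*} [Group G] {φ : MulAut G} {g : G}
    (h : φ (φ g * g⁻¹) = φ g * g⁻¹) (m : ℕ) : (φ ^ m) g = (φ g * g⁻¹) ^ m * g := by
  induction m with
  | zero => simp
  | succ m ih => rw [pow_succ', MulAut.mul_apply, ih, map_mul, map_pow, h, pow_succ]; group

/-- The `p`-primary component of the center of a subgroup, as a subgroup of the whole group. -/
def Subgroup.centerPrimaryComponent {G : Type*} [Group G] (N : Subgroup G) (p : ℕ) :
    Subgroup G where
  carrier := {x : G | x ∈ N ∧ (∀ y ∈ N, x * y = y * x) ∧ ∃ k : ℕ, x ^ (p ^ k) = 1}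
  one_mem' := ⟨N.one_mem, by simp, 0, by simp⟩
  mul_mem' := by
    rintro a b ⟨ha, hac, k, hk⟩ ⟨hb, hbc, l, hl⟩
    refine ⟨N.mul_mem ha hb, fun y hy => ?_, k + l, ?_⟩
    · rw [mul_assoc, hbc y hy, ← mul_assoc, hac y hy, mul_assoc]
    · rw [(show Commute a b from hac b hb).mul_pow, pow_add, pow_mul, hk, one_pow, one_mul,
        mul_comm, pow_mul, hl, one_pow]
  inv_mem' := by
    rintro a ⟨ha, hac, k, hk⟩
    exact ⟨N.inv_mem ha, fun y hy => (show Commute a y from hac y hy).inv_left, k, by simp [hk]⟩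

theorem Subgroup.centerPrimaryComponent_normal {G : Type*} [Group G] {N : Subgroup G}
    (hN : N.Normal) (p : ℕ) : (N.centerPrimaryComponent p).Normal where
  conj_mem := by
    rintro x ⟨hx, hxc, k, hk⟩ g
    refine ⟨hN.conj_mem x hx g, fun y hy => ?_, k, by rw [conj_pow, hk]; simp⟩
    have h := hxc _ (hN.conj_mem y hy g⁻¹)
    calc g * x * g⁻¹ * y = g * (x * (g⁻¹ * y * g⁻¹⁻¹)) * g⁻¹ := by group
      _ = g * (g⁻¹ * y * g⁻¹⁻¹ * x) * g⁻¹ := by rw [h]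
      _ = y * (g * x * g⁻¹) := by group

/-- If an automorphism `φ` of `p`-power order fixes a normal subgroup `N` pointwise and
induces the identity on `G/N`, then it induces the identity on `G/P`, where `P` is the
`p`-primary component of the center of `N` (a normal subgroup of `G`). -/
theorem stmt_10 (G : Type*) [Group G] [Finite G] (p : ℕ) (hp : p.Prime)
    (φ : MulAut G) (hord : ∃ k : ℕ, orderOf φ = p ^ k)
    (N : Subgroup G) (hN : N.Normal)
    (hfix : ∀ n ∈ N, φ n = n) (hmod : ∀ g : G, φ g * g⁻¹ ∈ N) :
    ∃ P : Subgroup G,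
      (P : Set G) = {x : G | x ∈ N ∧ (∀ y ∈ N, x * y = y * x) ∧ ∃ k : ℕ, x ^ (p ^ k) = 1} ∧
      P.Normal ∧ ∀ g : G, φ g * g⁻¹ ∈ P := by
  obtain ⟨k, hk⟩ := hord
  refine ⟨N.centerPrimaryComponent p, rfl, Subgroup.centerPrimaryComponent_normal hN p,
    fun g => ⟨hmod g, fun y hy => MulAut.map_mul_inv_comm_of_fixes hN hfix g hy, k, ?_⟩⟩
  have h := MulAut.pow_apply_eq_of_fixes (hfix _ (hmod g)) (p ^ k)
  rw [← hk, pow_orderOf_eq_one, MulAut.one_apply] at h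
  rw [← hk]
  exact right_eq_mul.mp h
end

section
/- Let p be a prime, G a finite group, and φ an automorphism of G whose order is a power of p. Assume there is a normal subgroup N of G such that φ(n) = n for all n ∈ N and φ(g) * g⁻¹ ∈ N for all g ∈ G. If moreover there exists a Sylow p-subgroup S of G with φ(s) = s for all s ∈ S, then φ is an inner automorphism of G. -/
/-- If a crossed homomorphism `z` is trivial on a subgroup `H` of finite index, then its power
`z ^ H.index` is principal. -/
theorem exists_pow_index_eq_of_crossedHom {G A : Type*} [Group G] [CommGroup A]
    (ρ : G →* MulAut A) (z : G → A) (hz : ∀ g h, z (g * h) = z g * ρ g (z h))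
    (H : Subgroup G) [H.FiniteIndex] (hH : ∀ s ∈ H, z s = 1) :
    ∃ c : A, ∀ g, z g ^ H.index = c * (ρ g c)⁻¹ := by
  classical
  let := H.fintypeQuotientOfFiniteIndex
  have hcoset : ∀ a b : G, QuotientGroup.leftRel H a b → z a = z b := by
    intro a b hab
    have h := hz a (a⁻¹ * b)
    rw [hH _ (QuotientGroup.leftRel_apply.mp hab), map_one, mul_one, mul_inv_cancel_left] at h
    exact h.symm
  let f : G ⧸ H → A := Quotient.lift z hcoset
  have hf : ∀ (g : G) (x : G ⧸ H), f (g • x) = z g * ρ g (f x) := by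
    intro g x
    induction x using QuotientGroup.induction_on with
    | H a => exact hz g a
  refine ⟨∏ x, f x, fun g => eq_mul_inv_of_mul_eq ?_⟩
  calc z g ^ H.index * ρ g (∏ x, f x) = ∏ x, f (g • x) := by
        simp only [hf, Finset.prod_mul_distrib, map_prod, Finset.prod_const, Finset.card_univ,
          Subgroup.index, Nat.card_eq_fintype_card]
    _ = ∏ x, f x := Equiv.prod_comp (MulAction.toPerm g) f

/-- If `φ` fixes the normal subgroup `N` pointwise, then every `φ g * g⁻¹` centralizes `N`. -/
theorem mul_inv_mem_centralizer_of_fixes {G : Type*} [Group G] (φ : MulAut G) (N : Subgroup G)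
    [hN : N.Normal] (hfix : ∀ n ∈ N, φ n = n) (g : G) :
    φ g * g⁻¹ ∈ Subgroup.centralizer (N : Set G) := by
  rw [Subgroup.mem_centralizer_iff]
  intro n hn
  have h := hfix _ (hN.conj_mem' n hn g)
  rw [map_mul, map_mul, map_inv, hfix n hn] at h
  have h' : n * φ g = φ g * (g⁻¹ * n * g) := by rw [← h]; group
  rw [← mul_assoc, h']
  group

/-- If `φ` fixes `φ g * g⁻¹`, then the powers of `φ` multiply `g` by the powers of this element. -/
theorem pow_apply_eq_of_fixes_mul_inv {G : Type*} [Group G] (φ : MulAut G) (g : G)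
    (hg : φ (φ g * g⁻¹) = φ g * g⁻¹) (k : ℕ) : (φ ^ k) g = (φ g * g⁻¹) ^ k * g := by
  induction k with
  | zero => simp
  | succ k ih => rw [pow_succ', MulAut.mul_apply, ih, map_mul, map_pow, hg, pow_succ]; group

/-- If an automorphism `φ` of `p`-power order fixes a normal subgroup `N` pointwise,
induces the identity on `G/N`, and fixes a Sylow `p`-subgroup of `G` pointwise, then `φ`
is inner. -/
theorem stmt_11 (G : Type*) [Group G] [Finite G] (p : ℕ) (hp : p.Prime)
    (φ : MulAut G) (hord : ∃ k : ℕ, orderOf φ = p ^ k)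
    (N : Subgroup G) (hN : N.Normal)
    (hfix : ∀ n ∈ N, φ n = n) (hmod : ∀ g : G, φ g * g⁻¹ ∈ N)
    (S : Sylow p G) (hS : ∀ s ∈ (S : Subgroup G), φ s = s) :
    IsInnerAut φ := by
  have : Fact p.Prime := ⟨hp⟩
  let A : Subgroup G := N ⊓ Subgroup.centralizer (N : Set G)
  have hA : A.Normal := inferInstance
  let : CommGroup A :=
    { mul_comm := fun a b => Subtype.ext (Subgroup.mem_centralizer_iff.mp b.2.2 a a.2.1) }
  let z : G → A := fun g => ⟨φ g * g⁻¹, hmod g, mul_inv_mem_centralizer_of_fixes φ N hfix g⟩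
  have hz : ∀ g h, z (g * h) = z g * MulAut.conjNormal g (z h) := by
    intro g h
    ext
    simp only [z, Subgroup.coe_mul, MulAut.conjNormal_apply, map_mul]
    group
  obtain ⟨c, hc⟩ := exists_pow_index_eq_of_crossedHom MulAut.conjNormal z hz (S : Subgroup G)
    fun s hs => Subtype.ext (by simp [z, hS s hs])
  obtain ⟨k, hk⟩ := hord
  have hzk : ∀ g, z g ^ p ^ k = 1 := by
    intro g
    have h := pow_apply_eq_of_fixes_mul_inv φ g (hfix _ (hmod g)) (p ^ k)
    rw [← hk, pow_orderOf_eq_one, MulAut.one_apply, right_eq_mul, hk] at h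
    exact Subtype.ext h
  have hcop : (S : Subgroup G).index.Coprime (p ^ k) :=
    ((hp.coprime_iff_not_dvd.mpr S.not_dvd_index).pow_left k).symm
  obtain ⟨r, hr⟩ := Int.mod_coprime hcop
  have hzr : ∀ g, z g = c ^ r * (MulAut.conjNormal g (c ^ r))⁻¹ := by
    intro g
    have hord_dvd : (orderOf (z g) : ℤ) ∣ ((p ^ k : ℕ) : ℤ) :=
      Int.natCast_dvd_natCast.mpr (orderOf_dvd_of_pow_eq_one (hzk g))
    calc z g = z g ^ (((S : Subgroup G).index : ℤ) * r) := by
          rw [zpow_eq_zpow_iff_modEq.mpr (hr.of_dvd hord_dvd), zpow_one]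
      _ = c ^ r * (MulAut.conjNormal g (c ^ r))⁻¹ := by
          rw [zpow_mul, zpow_natCast, hc, mul_zpow, inv_zpow, map_zpow]
  refine ⟨((c ^ r : A) : G), MulEquiv.ext fun g => ?_⟩
  have h := congrArg (fun a : A => (a : G) * g) (hzr g)
  simp only [z, inv_mul_cancel_right, Subgroup.coe_mul, Subgroup.coe_inv,
    MulAut.conjNormal_apply] at h
  rw [h, MulAut.conj_apply]
  group
end
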